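/- arXiv:2401.17204 — 7 statements merged into one kernel-verified Lean document; each statement's English description precedes it below -/
import Mathlib

section
/- Every U-tree has exactly a + b + 1 elements. (Hence the U-Tamari complex, whose facets are the U-trees, is pure of dimension a + b.) -/
/-- A sequence `u 0, …, u a` of positive integers is unimodular if it increases
up to some index `k ≤ a` and decreases afterwards. -/
def IsUnimodular (a : ℕ) (u : ℕ → ℕ) : Prop :=
  (∀ i, i ≤ a → 0 < u i) ∧
  ∃ k, k ≤ a ∧ (∀ i j, i ≤ j → j ≤ k → u i ≤ u j) ∧
    (∀ i j, k ≤ i → i ≤ j → j ≤ a → u j ≤ u i)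

/-- The stack set of the sequence `u 0, …, u a`: the point in column `i` and
row `j` (rows increasing downward) belongs to it iff `i ≤ a` and `j < u i`. -/
def stackSet (a : ℕ) (u : ℕ → ℕ) : Set (ℕ × ℕ) :=
  {p | p.1 ≤ a ∧ p.2 < u p.1}

/-- Two points `p, q` are `U`-incompatible if one is strictly southwest or strictly
northeast of the other and the whole rectangle spanned by them lies inside `U`. -/
def Incompat (U : Set (ℕ × ℕ)) (p q : ℕ × ℕ) : Prop :=
  ((p.1 < q.1 ∧ q.2 < p.2) ∨ (q.1 < p.1 ∧ p.2 < q.2)) ∧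
  ∀ k l : ℕ, min p.1 q.1 ≤ k → k ≤ max p.1 q.1 → min p.2 q.2 ≤ l → l ≤ max p.2 q.2 →
    (k, l) ∈ U

/-- `U`-compatibility. -/
def Compat (U : Set (ℕ × ℕ)) (p q : ℕ × ℕ) : Prop := ¬ Incompat U p q

/-- A `U`-tree is a maximal (under inclusion) pairwise `U`-compatible subset of `U`. -/
def IsUTree (U T : Set (ℕ × ℕ)) : Prop :=
  T ⊆ U ∧ T.Pairwise (Compat U) ∧
    ∀ T' : Set (ℕ × ℕ), T' ⊆ U → T'.Pairwise (Compat U) → T ⊆ T' → T' = T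

/-- In a stack set, a strictly southwest-northeast pair is incompatible as soon as its
southeast corner lies in the set. -/
theorem incompat_of_corner_mem {a : ℕ} {u : ℕ → ℕ} (hu : IsUnimodular a u) {p q : ℕ × ℕ}
    (hp : p ∈ stackSet a u) (h1 : p.1 < q.1) (h2 : q.2 < p.2)
    (hc : (q.1, p.2) ∈ stackSet a u) : Incompat (stackSet a u) p q := by
  refine ⟨Or.inl ⟨h1, h2⟩, fun k l hk1 hk2 _ hl2 => ?_⟩
  obtain ⟨-, m, hm, hinc, hdec⟩ := hu
  simp only [stackSet, Set.mem_ofPred_eq] at hp hc ⊢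
  rcases le_total k m with hkm | hkm
  · have := hinc p.1 k (by omega) hkm
    omega
  · have := hdec k q.1 hkm (by omega) hc.1
    omega

theorem Incompat.symm {U : Set (ℕ × ℕ)} {p q : ℕ × ℕ} (h : Incompat U p q) :
    Incompat U q p := by
  refine ⟨by have := h.1; tauto, fun k l h1 h2 h3 h4 => h.2 k l ?_ ?_ ?_ ?_⟩ <;> omega

/-- The southeast corner of a southwest-northeast pair of points of a `U`-tree is not in `U`. -/
theorem IsUTree.corner_notMem {a : ℕ} {u : ℕ → ℕ} (hu : IsUnimodular a u) {T : Set (ℕ × ℕ)}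
    (hT : IsUTree (stackSet a u) T) {p q : ℕ × ℕ} (hp : p ∈ T) (hq : q ∈ T)
    (h1 : p.1 < q.1) (h2 : q.2 < p.2) : (q.1, p.2) ∉ stackSet a u := fun hc =>
  hT.2.1 hp hq (fun h => by simp [h] at h1) (incompat_of_corner_mem hu (hT.1 hp) h1 h2 hc)

/-- A point of `U` forming no southwest-northeast pair with southeast corner in `U` with the
points of a `U`-tree belongs to that tree. -/
theorem IsUTree.mem_of_corner_notMem {U T : Set (ℕ × ℕ)} (hT : IsUTree U T) {x : ℕ × ℕ}
    (hx : x ∈ U)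
    (hsw : ∀ r ∈ T, r.1 < x.1 → x.2 < r.2 → (x.1, r.2) ∉ U)
    (hne : ∀ r ∈ T, x.1 < r.1 → r.2 < x.2 → (r.1, x.2) ∉ U) : x ∈ T := by
  have hcompat : ∀ r ∈ T, Compat U x r := by
    rintro r hr ⟨h | h, hrect⟩
    · exact hne r hr h.1 h.2 (hrect _ _ (by omega) (by omega) (by omega) (by omega))
    · exact hsw r hr h.1 h.2 (hrect _ _ (by omega) (by omega) (by omega) (by omega))
  rw [← hT.2.2 (insert x T) (Set.insert_subset hx hT.1) ?_ (Set.subset_insert x T)]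
  · exact Set.mem_insert x T
  · refine hT.2.1.insert fun r hr _ => ⟨hcompat r hr, fun h => hcompat r hr h.symm⟩

theorem IsUTree.zero_mem {a : ℕ} {u : ℕ → ℕ} (hu : IsUnimodular a u) {T : Set (ℕ × ℕ)}
    (hT : IsUTree (stackSet a u) T) : (0, 0) ∈ T :=
  hT.mem_of_corner_notMem ⟨Nat.zero_le a, hu.1 0 (Nat.zero_le a)⟩
    (fun _ _ h => absurd h (Nat.not_lt_zero _)) (fun _ _ _ h => absurd h (Nat.not_lt_zero _))

/-- Every column meets a `U`-tree. -/
theorem IsUTree.exists_mem_column {a : ℕ} {u : ℕ → ℕ} (hu : IsUnimodular a u)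
    {T : Finset (ℕ × ℕ)} (hT : IsUTree (stackSet a u) T) {i : ℕ} (hi : i ≤ a) :
    ∃ p ∈ T, p.1 = i := by
  obtain ⟨q, hq, hmax⟩ := (T.filter fun q => q.1 ≤ i ∧ q.2 < u i).exists_max_image Prod.snd
    ⟨(0, 0), by simpa using ⟨hT.zero_mem hu, hu.1 i hi⟩⟩
  simp only [Finset.mem_filter] at hq hmax
  refine ⟨(i, q.2), hT.mem_of_corner_notMem (x := (i, q.2)) ⟨hi, hq.2.2⟩ ?_ ?_, rfl⟩
  · intro r hr h1 h2 hc
    have := hmax r ⟨hr, h1.le, hc.2⟩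
    simp only at h2
    omega
  · intro r hr h1 h2
    exact hT.corner_notMem hu (p := q) hq.1 hr (lt_of_le_of_lt hq.2.1 h1) h2

/-- Every row of `U` meets a `U`-tree. -/
theorem IsUTree.exists_mem_row {a : ℕ} {u : ℕ → ℕ} (hu : IsUnimodular a u)
    {T : Finset (ℕ × ℕ)} (hT : IsUTree (stackSet a u) T) {j : ℕ}
    (hj : ∃ i, i ≤ a ∧ j < u i) : ∃ p ∈ T, p.2 = j := by
  classical
  rcases (T.filter fun q => q.2 ≤ j ∧ j < u q.1).eq_empty_or_nonempty with hE | hE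
  · have hE' : ∀ q ∈ T, q.2 ≤ j → ¬ j < u q.1 := fun q hq h1 h2 => by
      have : q ∈ T.filter fun q => q.2 ≤ j ∧ j < u q.1 := by simp [hq, h1, h2]
      simp [hE] at this
    refine ⟨(Nat.find hj, j), hT.mem_of_corner_notMem (Nat.find_spec hj) ?_ ?_, rfl⟩
    · intro r hr h1 h2 hc
      have hrU := hT.1 hr
      exact Nat.find_min hj h1 ⟨hrU.1, lt_trans h2 hrU.2⟩
    · intro r hr h1 h2 hc
      exact hE' r hr (le_of_lt h2) hc.2
  · obtain ⟨q, hq, hmax⟩ := Finset.exists_max_image _ Prod.fst hE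
    simp only [Finset.mem_filter] at hq hmax
    refine ⟨(q.1, j), hT.mem_of_corner_notMem (x := (q.1, j)) ⟨(hT.1 hq.1).1, hq.2.2⟩ ?_ ?_, rfl⟩
    · intro r hr h1 h2
      exact hT.corner_notMem hu (q := q) hr hq.1 h1 (lt_of_le_of_lt hq.2.1 h2)
    · intro r hr h1 h2 hc
      have := hmax r ⟨hr, le_of_lt h2, hc.2⟩
      simp only at h1
      omega

/-- Every point of a `U`-tree other than the root has a point of the tree above it in its
column or to the left of it in its row. -/
theorem IsUTree.exists_above_or_left {a : ℕ} {u : ℕ → ℕ} (hu : IsUnimodular a u)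
    {T : Finset (ℕ × ℕ)} (hT : IsUTree (stackSet a u) T) {p : ℕ × ℕ} (hp : p ∈ T)
    (h0 : p ≠ (0, 0)) :
    (∃ q ∈ T, q.1 = p.1 ∧ q.2 < p.2) ∨ (∃ q ∈ T, q.2 = p.2 ∧ q.1 < p.1) := by
  by_contra! hcon
  obtain ⟨hup, hleft⟩ := hcon
  have hpU := hT.1 hp
  obtain ⟨q, hq, hmax⟩ := (T.filter fun q => q.1 ≤ p.1 ∧ q.2 ≤ p.2 ∧ q ≠ p).exists_max_image
    Prod.snd ⟨(0, 0), by simpa using ⟨hT.zero_mem hu, h0.symm⟩⟩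
  simp only [Finset.mem_filter] at hq hmax
  obtain ⟨hqT, hq1, hq2, hqp⟩ := hq
  have hlt : q.2 < p.2 := by
    refine lt_of_le_of_ne hq2 fun h => hqp (Prod.ext ?_ h)
    exact le_antisymm hq1 (hleft q hqT h)
  have hmem : (p.1, q.2) ∈ T := by
    refine hT.mem_of_corner_notMem (x := (p.1, q.2)) ⟨hpU.1, lt_trans hlt hpU.2⟩ ?_ ?_
    · intro r hr h1 h2 hc
      simp only at h1 h2
      rcases lt_trichotomy r.2 p.2 with h | h | h
      · have := hmax r ⟨hr, h1.le, h.le, fun e => by simp [e] at h⟩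
        omega
      · have := hleft r hr h
        omega
      · exact hT.corner_notMem hu hr hp h1 h hc
    · intro r hr h1 h2
      exact hT.corner_notMem hu (p := q) hqT hr (lt_of_le_of_lt hq1 h1) h2
  have := hup _ hmem rfl
  simp only at this
  omega

/-- The number of points minimal for `g` in their fibre of `f` is the number of fibres. -/
theorem card_filter_fibre_min {α : Type*} (T : Finset α) (f g : α → ℕ)
    (hfg : ∀ x y, f x = f y → g x = g y → x = y) :
    (T.filter fun x => ∀ y ∈ T, f y = f x → g x ≤ g y).card = (T.image f).card := by
  have himage : (T.filter fun x => ∀ y ∈ T, f y = f x → g x ≤ g y).image f = T.image f := by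
    ext n
    simp only [Finset.mem_image, Finset.mem_filter]
    constructor
    · rintro ⟨x, hx, rfl⟩
      exact ⟨x, hx.1, rfl⟩
    · rintro ⟨x, hx, rfl⟩
      obtain ⟨y, hy, hmin⟩ := (T.filter fun y => f y = f x).exists_min_image g ⟨x, by simp [hx]⟩
      simp only [Finset.mem_filter] at hy hmin
      exact ⟨y, ⟨hy.1, fun z hz h => hmin z ⟨hz, h.trans hy.2⟩⟩, hy.2⟩
  rw [← himage, Finset.card_image_of_injOn]
  intro x hx y hy h
  simp only [Finset.coe_filter, Set.mem_ofPred_eq] at hx hy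
  exact hfg x y h (le_antisymm (hx.2 y hy.1 h.symm) (hy.2 x hx.1 h))

/-- Every `U`-tree has exactly `a + b + 1` elements, where `U` is the
stack set of a unimodular sequence `u 0, …, u a` of positive integers with
`b + 1 = max_i u i`.  Hence the `U`-Tamari complex is pure of dimension `a + b`. -/
theorem utree_card (a b : ℕ) (u : ℕ → ℕ) (hu : IsUnimodular a u)
    (hub : ∀ i, i ≤ a → u i ≤ b + 1) (hmax : ∃ i, i ≤ a ∧ u i = b + 1)
    (T : Set (ℕ × ℕ)) (hT : IsUTree (stackSet a u) T) :
    T.ncard = a + b + 1 := by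
  have hfin : T.Finite := by
    refine (Finset.range (a + 1) ×ˢ Finset.range (b + 1)).finite_toSet.subset fun p hp => ?_
    have hpU := hT.1 hp
    have := hub p.1 hpU.1
    simpa using ⟨hpU.1, Nat.le_of_lt_succ (lt_of_lt_of_le hpU.2 this)⟩
  lift T to Finset (ℕ × ℕ) using hfin
  rw [Set.ncard_coe_finset]
  have hcol : T.image Prod.fst = Finset.range (a + 1) := by
    ext i
    rw [Finset.mem_image, Finset.mem_range, Nat.lt_succ_iff]
    refine ⟨?_, fun hi => hT.exists_mem_column hu hi⟩
    rintro ⟨p, hp, rfl⟩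
    exact (hT.1 hp).1
  have hrow : T.image Prod.snd = Finset.range (b + 1) := by
    ext j
    rw [Finset.mem_image, Finset.mem_range]
    constructor
    · rintro ⟨p, hp, rfl⟩
      exact lt_of_lt_of_le (hT.1 hp).2 (hub _ (hT.1 hp).1)
    · intro hj
      obtain ⟨i, hi, hui⟩ := hmax
      exact hT.exists_mem_row hu ⟨i, hi, hui ▸ hj⟩
  have hC := card_filter_fibre_min T Prod.fst Prod.snd fun x y h1 h2 => Prod.ext h1 h2
  have hR := card_filter_fibre_min T Prod.snd Prod.fst fun x y h1 h2 => Prod.ext h2 h1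
  rw [hcol, Finset.card_range] at hC
  rw [hrow, Finset.card_range] at hR
  have hcard := Finset.card_union_add_card_inter
    (T.filter fun x => ∀ y ∈ T, y.1 = x.1 → x.2 ≤ y.2)
    (T.filter fun x => ∀ y ∈ T, y.2 = x.2 → x.1 ≤ y.1)
  have hunion : (T.filter fun x => ∀ y ∈ T, y.1 = x.1 → x.2 ≤ y.2) ∪
      (T.filter fun x => ∀ y ∈ T, y.2 = x.2 → x.1 ≤ y.1) = T := by
    rw [← Finset.filter_or, Finset.filter_eq_self]
    intro p hp
    by_contra! hcon
    obtain ⟨⟨q, hq, hq1, hq2⟩, r, hr, hr1, hr2⟩ := hcon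
    refine hT.corner_notMem hu hr hq (by omega) (by omega) ?_
    rw [hq1, hr1]
    exact hT.1 hp
  have hinter : (T.filter fun x => ∀ y ∈ T, y.1 = x.1 → x.2 ≤ y.2) ∩
      (T.filter fun x => ∀ y ∈ T, y.2 = x.2 → x.1 ≤ y.1) = {(0, 0)} := by
    rw [← Finset.filter_and]
    ext p
    rw [Finset.mem_filter, Finset.mem_singleton]
    constructor
    · rintro ⟨hp, htop, hleft⟩
      by_contra h0
      rcases hT.exists_above_or_left hu hp h0 with ⟨q, hq, h1, h2⟩ | ⟨q, hq, h1, h2⟩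
      · exact absurd (htop q hq h1) (by omega)
      · exact absurd (hleft q hq h1) (by omega)
    · rintro rfl
      exact ⟨hT.zero_mem hu, fun _ _ _ => Nat.zero_le _, fun _ _ _ => Nat.zero_le _⟩
  rw [hunion, hinter, hC, hR, Finset.card_singleton] at hcard
  omega
end

section
/- For every ν-path μ = (μ_0,…,μ_b) there is exactly one U_{δ,ν}-tree T such that, for each j ∈ {0,…,b}, T has exactly μ_{b−j} + 1 elements in row j. Consequently, the set of ν-paths and the set of U_{δ,ν}-trees are in bijection and have the same cardinality. -/
/-- `μ` is a `ν`-path: a monotone lattice path from `(0,0)` to `(a,b)` weakly above `ν`,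
where `μ i` (resp. `ν i`) is the number of east steps at height `i`. -/
def IsNuPath (b : ℕ) (ν μ : ℕ → ℕ) : Prop :=
  (∀ j, j ≤ b → ∑ i ∈ Finset.range (j + 1), μ i ≤ ∑ i ∈ Finset.range (j + 1), ν i) ∧
  ∑ i ∈ Finset.range (b + 1), μ i = ∑ i ∈ Finset.range (b + 1), ν i

/-- The stack set `U_{δ,ν}`: the set of lattice points weakly above the path
`(E^{ν_b−δ_b} S ⋯ E^{ν_1−δ_1} S) E^{ν_0} (N E^{δ_1} ⋯ N E^{δ_b})` inside its bounding
rectangle, in (column `i`, row `j`) coordinates with rows increasing downward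
(row `j` has height `b − j`).  The point `(i, j)` belongs to it iff `j ≤ b` and `i` lies
between the column where the descending branch reaches row `j` and the column where the
ascending branch leaves row `j`. -/
def stackSetDN (b : ℕ) (ν δ : ℕ → ℕ) : Set (ℕ × ℕ) :=
  {p | p.2 ≤ b ∧
    (∑ m ∈ Finset.Icc (b - p.2 + 1) b, (ν m - δ m)) ≤ p.1 ∧
    p.1 ≤ (∑ m ∈ Finset.Icc 1 b, (ν m - δ m)) + ν 0 + ∑ m ∈ Finset.Icc 1 (b - p.2), δ m}

/-! ### The largest elements of a finite set -/

/-- The number of elements of `s` that are larger than `i`. -/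
def rankAbove (s : Finset ℕ) (i : ℕ) : ℕ := (s.filter (i < ·)).card

/-- The set of the `n` largest elements of `s`. -/
def upperPart (s : Finset ℕ) (n : ℕ) : Finset ℕ := s.filter (rankAbove s · < n)

lemma mem_upperPart {s : Finset ℕ} {n i : ℕ} :
    i ∈ upperPart s n ↔ i ∈ s ∧ rankAbove s i < n := by
  simp [upperPart]

lemma rankAbove_lt_of_lt {s : Finset ℕ} {i j : ℕ} (hj : j ∈ s) (hij : i < j) :
    rankAbove s j < rankAbove s i := by
  refine Finset.card_lt_card (Finset.ssubset_iff_subset_ne.2 ⟨fun x hx => ?_, fun h => ?_⟩)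
  · simp only [Finset.mem_filter] at hx ⊢
    exact ⟨hx.1, hij.trans hx.2⟩
  · have : j ∈ s.filter (i < ·) := by simp [hj, hij]
    rw [← h] at this
    simp at this

lemma rankAbove_lt_card {s : Finset ℕ} {i : ℕ} (hi : i ∈ s) : rankAbove s i < s.card := by
  refine Finset.card_lt_card
    (Finset.ssubset_iff_subset_ne.2 ⟨Finset.filter_subset _ _, fun h => ?_⟩)
  rw [← h] at hi
  simp at hi

lemma rankAbove_injOn (s : Finset ℕ) : Set.InjOn (rankAbove s) s := by
  intro i hi j hj h
  rcases lt_trichotomy i j with hij | hij | hij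
  · have := rankAbove_lt_of_lt hj hij
    omega
  · exact hij
  · have := rankAbove_lt_of_lt hi hij
    omega

lemma image_rankAbove (s : Finset ℕ) : s.image (rankAbove s) = Finset.range s.card := by
  refine Finset.eq_of_subset_of_card_le (fun n hn => ?_) ?_
  · obtain ⟨i, hi, rfl⟩ := Finset.mem_image.1 hn
    exact Finset.mem_range.2 (rankAbove_lt_card hi)
  · rw [Finset.card_image_of_injOn (rankAbove_injOn s), Finset.card_range]

lemma exists_rankAbove_eq {s : Finset ℕ} {n : ℕ} (hn : n < s.card) :
    ∃ i ∈ s, rankAbove s i = n := by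
  have : n ∈ s.image (rankAbove s) := by rw [image_rankAbove]; simpa using hn
  simpa using this

lemma card_upperPart {s : Finset ℕ} {n : ℕ} (hn : n ≤ s.card) : (upperPart s n).card = n := by
  have h : (upperPart s n).image (rankAbove s) = Finset.range n := by
    ext m
    simp only [Finset.mem_image, mem_upperPart, Finset.mem_range]
    constructor
    · rintro ⟨i, hi, rfl⟩
      exact hi.2
    · intro hm
      obtain ⟨i, hi, rfl⟩ := exists_rankAbove_eq (hm.trans_le hn)
      exact ⟨i, ⟨hi, hm⟩, rfl⟩
  have hinj : Set.InjOn (rankAbove s) (upperPart s n) :=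
    (rankAbove_injOn s).mono fun i hi => (mem_upperPart.1 hi).1
  rw [← Finset.card_image_of_injOn hinj, h, Finset.card_range]

lemma upperPart_of_card_le {s : Finset ℕ} {n : ℕ} (hn : s.card ≤ n) : upperPart s n = s := by
  ext i
  rw [mem_upperPart]
  exact ⟨And.left, fun h => ⟨h, (rankAbove_lt_card h).trans_le hn⟩⟩

lemma eq_upperPart {s t : Finset ℕ} (hts : t ⊆ s)
    (hup : ∀ i ∈ t, ∀ i' ∈ s, i < i' → i' ∈ t) : t = upperPart s t.card := by
  refine Finset.eq_of_subset_of_card_le (fun i hi => mem_upperPart.2 ⟨hts hi, ?_⟩) ?_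
  · have h : rankAbove s i = rankAbove t i := by
      refine congrArg Finset.card (Finset.ext fun x => ?_)
      simp only [Finset.mem_filter]
      exact ⟨fun hx => ⟨hup i hi x hx.1 hx.2, hx.2⟩, fun hx => ⟨hts hx.1, hx.2⟩⟩
    rw [h]
    exact rankAbove_lt_card hi
  · rw [card_upperPart (Finset.card_le_card hts)]

lemma mem_upperPart_iff_exists_lt {s : Finset ℕ} {n i : ℕ} (hn : n < s.card) (hi : i ∈ s) :
    i ∈ upperPart s n ↔ ∃ p ∈ upperPart s (n + 1), p < i := by
  constructor
  · intro h
    obtain ⟨p, hp, hpn⟩ := exists_rankAbove_eq hn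
    refine ⟨p, mem_upperPart.2 ⟨hp, by omega⟩, ?_⟩
    have h1 := (mem_upperPart.1 h).2
    by_contra! hle
    rcases hle.lt_or_eq with hlt | rfl
    · have := rankAbove_lt_of_lt hp hlt
      omega
    · omega
  · rintro ⟨p, hp, hpi⟩
    have h1 := (mem_upperPart.1 hp).2
    have h2 := rankAbove_lt_of_lt hi hpi
    exact mem_upperPart.2 ⟨hi, by omega⟩

/-! ### Families of rows

Rows are indexed by their height `h ≤ b`; the row at height `h` is the interval
`[L h, R h]`, and these intervals grow with `h`. -/

/-- The intervals `[L h, R h]`, `h ≤ b`, are nonempty and increase with `h`. -/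
structure NestedRows (b : ℕ) (L R : ℕ → ℕ) : Prop where
  left_le : ∀ {k h}, k ≤ h → h ≤ b → L h ≤ L k
  right_le : ∀ {k h}, k ≤ h → h ≤ b → R k ≤ R h
  left_le_right : ∀ {h}, h ≤ b → L h ≤ R h

/-- Column `i` is forbidden at height `h` by a lower element of the family `F`. -/
def Blocked (R : ℕ → ℕ) (F : ℕ → Finset ℕ) (h i : ℕ) : Prop :=
  ∃ k < h, ∃ p ∈ F k, p < i ∧ i ≤ R k

/-- The family of rows `F` is the family of rows of a `U`-tree. -/
structure IsTreeRows (b : ℕ) (L R : ℕ → ℕ) (F : ℕ → Finset ℕ) : Prop where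
  subset : ∀ h ≤ b, F h ⊆ Finset.Icc (L h) (R h)
  not_blocked : ∀ h ≤ b, ∀ q ∈ F h, ¬ Blocked R F h q
  maximal : ∀ h ≤ b, ∀ i ∈ Finset.Icc (L h) (R h), ¬ Blocked R F h i →
    (∀ k, h < k → k ≤ b → ∀ q ∈ F k, i < q → R h < q) → i ∈ F h

/-- The columns forbidden at height `h` in the tree with `μ k + 1` elements at height `k`. -/
def deletedColumns (L R μ : ℕ → ℕ) : ℕ → Finset ℕ
  | 0 => ∅
  | h + 1 => deletedColumns L R μ h ∪
      upperPart (Finset.Icc (L h) (R h) \ deletedColumns L R μ h) (μ h)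

/-- The columns available at height `h` in the tree with `μ k + 1` elements at height `k`. -/
def availableColumns (L R μ : ℕ → ℕ) (h : ℕ) : Finset ℕ :=
  Finset.Icc (L h) (R h) \ deletedColumns L R μ h

/-- The row at height `h` of the tree with `μ k + 1` elements at height `k`. -/
def pathRow (L R μ : ℕ → ℕ) (h : ℕ) : Finset ℕ :=
  upperPart (availableColumns L R μ h) (μ h + 1)

section Rows

variable {b : ℕ} {L R μ : ℕ → ℕ} {F : ℕ → Finset ℕ}

lemma mem_availableColumns {h i : ℕ} : i ∈ availableColumns L R μ h ↔
    i ∈ Finset.Icc (L h) (R h) ∧ i ∉ deletedColumns L R μ h := by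
  simp only [availableColumns, Finset.mem_sdiff]

lemma mem_deletedColumns_succ {h i : ℕ} : i ∈ deletedColumns L R μ (h + 1) ↔
    i ∈ deletedColumns L R μ h ∨ i ∈ upperPart (availableColumns L R μ h) (μ h) := by
  simp only [deletedColumns, availableColumns, Finset.mem_union]

lemma deletedColumns_subset (hN : NestedRows b L R) {h : ℕ} :
    ∀ {H : ℕ}, h ≤ H → H ≤ b → deletedColumns L R μ h ⊆ Finset.Icc (L H) (R H) := by
  induction h with
  | zero => simp [deletedColumns]
  | succ h ih =>
    intro H hH hHb i hi
    rcases mem_deletedColumns_succ.1 hi with hi | hi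
    · exact ih (by omega) hHb hi
    · have h1 := Finset.mem_Icc.1 (mem_availableColumns.1 (mem_upperPart.1 hi).1).1
      have h2 := hN.left_le (k := h) (by omega) hHb
      have h3 := hN.right_le (k := h) (by omega) hHb
      exact Finset.mem_Icc.2 ⟨by omega, by omega⟩

lemma card_availableColumns_add (hN : NestedRows b L R) {h : ℕ} (hb : h ≤ b) :
    (availableColumns L R μ h).card + (deletedColumns L R μ h).card + L h = R h + 1 := by
  have h1 := Finset.card_sdiff_add_card_eq_card
    (deletedColumns_subset (μ := μ) hN le_rfl hb)
  have h2 := hN.left_le_right hb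
  rw [Nat.card_Icc] at h1
  unfold availableColumns
  omega

lemma card_deletedColumns (hN : NestedRows b L R) {h : ℕ} (hb : h ≤ b + 1)
    (hμ : ∀ k < h, ∑ m ∈ Finset.range (k + 1), μ m + L k ≤ R k) :
    (deletedColumns L R μ h).card = ∑ m ∈ Finset.range h, μ m := by
  induction h with
  | zero => simp [deletedColumns]
  | succ h ih =>
    have ih := ih (by omega) fun k hk => hμ k (by omega)
    have h1 := card_availableColumns_add (μ := μ) hN (h := h) (by omega)
    have h2 := hμ h (by omega)
    rw [Finset.sum_range_succ] at h2 ⊢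
    have hd : Disjoint (deletedColumns L R μ h)
        (upperPart (availableColumns L R μ h) (μ h)) :=
      Finset.disjoint_right.2 fun i hi => (mem_availableColumns.1 (mem_upperPart.1 hi).1).2
    have h3 := Finset.card_union_of_disjoint hd
    rw [card_upperPart (by omega), ih] at h3
    exact h3

lemma card_availableColumns (hN : NestedRows b L R) {h : ℕ} (hb : h ≤ b)
    (hμ : ∀ k < h, ∑ m ∈ Finset.range (k + 1), μ m + L k ≤ R k) :
    (availableColumns L R μ h).card + ∑ m ∈ Finset.range h, μ m + L h = R h + 1 := by
  rw [← card_deletedColumns hN (by omega) hμ]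
  exact card_availableColumns_add hN hb

lemma lt_card_availableColumns (hN : NestedRows b L R) {h : ℕ} (hb : h ≤ b)
    (hμ : ∀ k ≤ h, ∑ m ∈ Finset.range (k + 1), μ m + L k ≤ R k) :
    μ h < (availableColumns L R μ h).card := by
  have h1 := card_availableColumns hN hb fun k hk => hμ k hk.le
  have h2 := hμ h le_rfl
  rw [Finset.sum_range_succ] at h2
  omega

lemma blocked_succ {h i : ℕ} :
    Blocked R F (h + 1) i ↔ Blocked R F h i ∨ ∃ p ∈ F h, p < i ∧ i ≤ R h := by
  constructor
  · rintro ⟨k, hk, hp⟩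
    rcases (Nat.lt_succ_iff.1 hk).lt_or_eq with hk | rfl
    · exact Or.inl ⟨k, hk, hp⟩
    · exact Or.inr hp
  · rintro (⟨k, hk, hp⟩ | hp)
    · exact ⟨k, by omega, hp⟩
    · exact ⟨h, by omega, hp⟩

lemma blocked_iff_mem_deletedColumns (hN : NestedRows b L R) {h : ℕ} (hb : h ≤ b + 1)
    (hμ : ∀ k < h, ∑ m ∈ Finset.range (k + 1), μ m + L k ≤ R k)
    (hF : ∀ k < h, F k = pathRow L R μ k) (i : ℕ) :
    Blocked R F h i ↔ i ∈ deletedColumns L R μ h := by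
  induction h with
  | zero => simp [Blocked, deletedColumns]
  | succ h ih =>
    have hcard := lt_card_availableColumns (μ := μ) hN (h := h) (by omega)
      fun k hk => hμ k (by omega)
    rw [blocked_succ, mem_deletedColumns_succ, hF h (by omega),
      ih (by omega) (fun k hk => hμ k (by omega)) fun k hk => hF k (by omega)]
    refine or_congr_right' fun hi => ⟨?_, fun h1 => ?_⟩
    · rintro ⟨p, hp, hpi, hiR⟩
      have h1 := Finset.mem_Icc.1 (mem_availableColumns.1 (mem_upperPart.1 hp).1).1
      have h2 : i ∈ availableColumns L R μ h :=
        mem_availableColumns.2 ⟨Finset.mem_Icc.2 ⟨by omega, hiR⟩, hi⟩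
      exact (mem_upperPart_iff_exists_lt hcard h2).2 ⟨p, hp, hpi⟩
    · have h2 := (mem_upperPart.1 h1).1
      obtain ⟨p, hp, hpi⟩ := (mem_upperPart_iff_exists_lt hcard h2).1 h1
      exact ⟨p, hp, hpi, (Finset.mem_Icc.1 (mem_availableColumns.1 h2).1).2⟩

lemma IsTreeRows.mem_of_lt (hF : IsTreeRows b L R F) {h i i' : ℕ} (hb : h ≤ b)
    (hi : i ∈ F h) (hi' : i' ∈ Finset.Icc (L h) (R h)) (hB : ¬ Blocked R F h i')
    (hlt : i < i') : i' ∈ F h := by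
  refine hF.maximal h hb i' hi' hB fun k hk hkb q hq hq' => ?_
  by_contra! hle
  exact hF.not_blocked k hkb q hq ⟨h, hk, i, hi, by omega, hle⟩

lemma IsTreeRows.not_blocked_left (hN : NestedRows b L R) (hF : IsTreeRows b L R F) {h : ℕ}
    (hb : h ≤ b) : ¬ Blocked R F h (L h) := by
  rintro ⟨k, hk, p, hp, hlt, -⟩
  have h1 := Finset.mem_Icc.1 (hF.subset k (by omega) hp)
  have h2 := hN.left_le hk.le hb
  omega

lemma IsTreeRows.nonempty (hN : NestedRows b L R) (hF : IsTreeRows b L R F) {h : ℕ}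
    (hb : h ≤ b) : (F h).Nonempty := by
  classical
  set s := (Finset.Icc (L h) (R h)).filter fun i => ¬ Blocked R F h i with hs
  have hne : s.Nonempty := ⟨L h, by
    simpa [hs] using ⟨hN.left_le_right hb, hF.not_blocked_left hN hb⟩⟩
  have hm := Finset.mem_filter.1 (s.max'_mem hne)
  refine ⟨_, hF.maximal h hb _ hm.1 hm.2 fun k hk hkb q hq hlt => ?_⟩
  by_contra! hle
  have hmL := (Finset.mem_Icc.1 hm.1).1
  have hqs : q ∉ s := fun hq' => by
    have := s.le_max' q hq'
    omega
  have hB : Blocked R F h q := by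
    by_contra hB
    exact hqs (Finset.mem_filter.2 ⟨Finset.mem_Icc.2 ⟨by omega, hle⟩, hB⟩)
  obtain ⟨k', hk', hp⟩ := hB
  exact hF.not_blocked k hkb q hq ⟨k', by omega, hp⟩

lemma IsTreeRows.eq_pathRow_and_sum_le (hN : NestedRows b L R) (hF : IsTreeRows b L R F)
    (hμ : ∀ h ≤ b, (F h).card = μ h + 1) (h : ℕ) (hb : h ≤ b) :
    F h = pathRow L R μ h ∧ ∑ m ∈ Finset.range (h + 1), μ m + L h ≤ R h := by
  induction h using Nat.strong_induction_on with
  | _ h ih =>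
    have hsum : ∀ k < h, ∑ m ∈ Finset.range (k + 1), μ m + L k ≤ R k :=
      fun k hk => (ih k hk (by omega)).2
    have hB := blocked_iff_mem_deletedColumns (F := F) hN (h := h) (by omega) hsum
      fun k hk => (ih k hk (by omega)).1
    have hsub : F h ⊆ availableColumns L R μ h := fun i hi =>
      mem_availableColumns.2 ⟨hF.subset h hb hi, fun hd => hF.not_blocked h hb i hi ((hB i).2 hd)⟩
    constructor
    · unfold pathRow
      rw [← hμ h hb]
      refine eq_upperPart hsub fun i hi i' hi' hlt => ?_
      rw [mem_availableColumns, ← hB] at hi'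
      exact hF.mem_of_lt hb hi hi'.1 hi'.2 hlt
    · have h1 := card_availableColumns hN hb hsum
      have h2 := Finset.card_le_card hsub
      rw [hμ h hb] at h2
      rw [Finset.sum_range_succ]
      omega

lemma IsTreeRows.sum_eq (hN : NestedRows b L R) (hF : IsTreeRows b L R F)
    (hμ : ∀ h ≤ b, (F h).card = μ h + 1) :
    ∑ m ∈ Finset.range (b + 1), μ m + L b = R b := by
  have hrow := hF.eq_pathRow_and_sum_le hN hμ
  have hsum : ∀ k < b, ∑ m ∈ Finset.range (k + 1), μ m + L k ≤ R k :=
    fun k hk => (hrow k hk.le).2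
  have hB := blocked_iff_mem_deletedColumns (F := F) hN (h := b) (by omega) hsum
    fun k hk => (hrow k hk.le).1
  have hsub : availableColumns L R μ b ⊆ F b := fun i hi => by
    rw [mem_availableColumns, ← hB] at hi
    exact hF.maximal b le_rfl i hi.1 hi.2 fun k hk hkb => by omega
  have h1 := card_availableColumns hN le_rfl hsum
  have h2 := Finset.card_le_card hsub
  have h3 := (hrow b le_rfl).2
  rw [hμ b le_rfl] at h2
  rw [Finset.sum_range_succ] at h3 ⊢
  omega

lemma card_pathRow (hN : NestedRows b L R)
    (hμ : ∀ k ≤ b, ∑ m ∈ Finset.range (k + 1), μ m + L k ≤ R k) {h : ℕ} (hb : h ≤ b) :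
    (pathRow L R μ h).card = μ h + 1 :=
  card_upperPart (lt_card_availableColumns hN hb fun k hk => hμ k (by omega))

lemma pathRow_subset (h : ℕ) : pathRow L R μ h ⊆ Finset.Icc (L h) (R h) :=
  fun _ hi => (mem_availableColumns.1 (mem_upperPart.1 hi).1).1

lemma upperPart_subset_pathRow (h : ℕ) :
    upperPart (availableColumns L R μ h) (μ h) ⊆ pathRow L R μ h := fun i hi => by
  have := mem_upperPart.1 hi
  exact mem_upperPart.2 ⟨this.1, by omega⟩

lemma pathRow_last (hN : NestedRows b L R)
    (hμ : ∀ k ≤ b, ∑ m ∈ Finset.range (k + 1), μ m + L k ≤ R k)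
    (htot : ∑ m ∈ Finset.range (b + 1), μ m + L b = R b) :
    pathRow L R μ b = availableColumns L R μ b := by
  have h1 := card_availableColumns hN le_rfl fun k hk => hμ k hk.le
  rw [Finset.sum_range_succ] at htot
  exact upperPart_of_card_le (by omega)

lemma exists_mem_pathRow (hN : NestedRows b L R)
    (hμ : ∀ k ≤ b, ∑ m ∈ Finset.range (k + 1), μ m + L k ≤ R k)
    (htot : ∑ m ∈ Finset.range (b + 1), μ m + L b = R b) {h x : ℕ} (hb : h < b)
    (hx : x ∈ Finset.Icc (L h) (R h)) (hd : x ∉ deletedColumns L R μ (h + 1)) :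
    ∃ k, h < k ∧ k ≤ b ∧ x ∈ pathRow L R μ k := by
  by_contra! hcon
  have hdel : ∀ k, h + 1 ≤ k → k ≤ b → x ∉ deletedColumns L R μ k := by
    intro k hk
    induction k, hk using Nat.le_induction with
    | base => exact fun _ => hd
    | succ k hk ih =>
      intro hkb hmem
      rcases mem_deletedColumns_succ.1 hmem with hm | hm
      · exact ih (by omega) hm
      · exact hcon k (by omega) (by omega) (upperPart_subset_pathRow k hm)
  refine hcon b hb le_rfl ?_
  rw [pathRow_last hN hμ htot, mem_availableColumns]
  have h1 := hN.left_le hb.le le_rfl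
  have h2 := hN.right_le hb.le le_rfl
  have h3 := Finset.mem_Icc.1 hx
  exact ⟨Finset.mem_Icc.2 ⟨by omega, by omega⟩, hdel b hb le_rfl⟩

lemma isTreeRows_pathRow (hN : NestedRows b L R)
    (hμ : ∀ k ≤ b, ∑ m ∈ Finset.range (k + 1), μ m + L k ≤ R k)
    (htot : ∑ m ∈ Finset.range (b + 1), μ m + L b = R b) :
    IsTreeRows b L R (pathRow L R μ) := by
  have hB : ∀ h ≤ b, ∀ i, Blocked R (pathRow L R μ) h i ↔ i ∈ deletedColumns L R μ h :=
    fun h hb => blocked_iff_mem_deletedColumns hN (by omega)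
      (fun k hk => hμ k (by omega)) fun _ _ => rfl
  refine ⟨fun h _ => pathRow_subset h, fun h hb q hq => ?_, fun h hb i hi hnB hup => ?_⟩
  · rw [hB h hb]
    exact (mem_availableColumns.1 (mem_upperPart.1 hq).1).2
  · rw [hB h hb] at hnB
    have hia := mem_availableColumns.2 ⟨hi, hnB⟩
    rcases hb.lt_or_eq with hlt | rfl
    · obtain ⟨x, hx, hxr⟩ := exists_rankAbove_eq
        (lt_card_availableColumns hN hb fun k hk => hμ k (by omega))
      rcases lt_or_ge i x with hix | hix
      · exfalso
        have hx' := mem_availableColumns.1 hx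
        have hxd : x ∉ deletedColumns L R μ (h + 1) := fun hm => by
          rcases mem_deletedColumns_succ.1 hm with hm | hm
          · exact hx'.2 hm
          · exact (mem_upperPart.1 hm).2.ne hxr
        obtain ⟨k, hk, hkb, hxk⟩ := exists_mem_pathRow hN hμ htot hlt hx'.1 hxd
        have h1 := hup k hk hkb x hxk hix
        have h2 := Finset.mem_Icc.1 hx'.1
        omega
      · refine mem_upperPart.2 ⟨hia, ?_⟩
        rcases hix.lt_or_eq with hlt' | rfl
        · have := rankAbove_lt_of_lt hia hlt'
          omega
        · omega
    · rwa [pathRow_last hN hμ htot]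

end Rows

/-! ### Trees in the stack set and their rows -/

/-- The set of points `(i, j)` with `j ≤ b` and `i` in the interval of height `b - j`. -/
def rowsRegion (b : ℕ) (L R : ℕ → ℕ) : Set (ℕ × ℕ) :=
  {p | p.2 ≤ b ∧ L (b - p.2) ≤ p.1 ∧ p.1 ≤ R (b - p.2)}

open Classical in
/-- The columns of the elements of `T` at height `h`. -/
noncomputable def rowsOf (b : ℕ) (L R : ℕ → ℕ) (T : Set (ℕ × ℕ)) (h : ℕ) : Finset ℕ :=
  (Finset.Icc (L h) (R h)).filter fun i => (i, b - h) ∈ T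

/-- The set of points whose rows are given by `F`. -/
def ofRows (b : ℕ) (F : ℕ → Finset ℕ) : Set (ℕ × ℕ) :=
  {p | p.2 ≤ b ∧ p.1 ∈ F (b - p.2)}

section Trees

variable {b : ℕ} {L R : ℕ → ℕ} {T : Set (ℕ × ℕ)}

lemma rowsOf_subset (h : ℕ) : rowsOf b L R T h ⊆ Finset.Icc (L h) (R h) := by
  simp only [rowsOf, Finset.filter_subset]

lemma mem_iff_mem_rowsOf (hT : T ⊆ rowsRegion b L R) {i j : ℕ} :
    (i, j) ∈ T ↔ j ≤ b ∧ i ∈ rowsOf b L R T (b - j) := by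
  constructor
  · intro h
    obtain ⟨h1, h2, h3⟩ := hT h
    simp only at h1 h2 h3
    refine ⟨h1, ?_⟩
    simp only [rowsOf, Finset.mem_filter, Finset.mem_Icc]
    rw [Nat.sub_sub_self h1]
    exact ⟨⟨h2, h3⟩, h⟩
  · rintro ⟨h1, h2⟩
    simp only [rowsOf, Finset.mem_filter] at h2
    rw [Nat.sub_sub_self h1] at h2
    exact h2.2

lemma mem_rowsOf {h i : ℕ} (hT : T ⊆ rowsRegion b L R) (hb : h ≤ b) :
    i ∈ rowsOf b L R T h ↔ (i, b - h) ∈ T := by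
  rw [mem_iff_mem_rowsOf hT, Nat.sub_sub_self hb]
  simp

lemma ofRows_rowsOf (hT : T ⊆ rowsRegion b L R) : ofRows b (rowsOf b L R T) = T := by
  ext ⟨i, j⟩
  rw [mem_iff_mem_rowsOf hT]
  rfl

lemma ofRows_subset {F : ℕ → Finset ℕ} (hF : ∀ h ≤ b, F h ⊆ Finset.Icc (L h) (R h)) :
    ofRows b F ⊆ rowsRegion b L R := fun _ hp =>
  ⟨hp.1, Finset.mem_Icc.1 (hF _ (Nat.sub_le _ _) hp.2)⟩

lemma ncard_row (hT : T ⊆ rowsRegion b L R) {j : ℕ} (hj : j ≤ b) :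
    {p ∈ T | p.2 = j}.ncard = (rowsOf b L R T (b - j)).card := by
  have h : {p ∈ T | p.2 = j} = (fun i => (i, j)) '' (rowsOf b L R T (b - j) : Set ℕ) := by
    ext ⟨i, j'⟩
    simp only [Set.mem_ofPred_eq, Set.mem_image, Finset.mem_coe, Prod.mk.injEq]
    constructor
    · rintro ⟨h, rfl⟩
      exact ⟨i, ((mem_iff_mem_rowsOf hT).1 h).2, rfl, rfl⟩
    · rintro ⟨i, h, rfl, rfl⟩
      exact ⟨(mem_iff_mem_rowsOf hT).2 ⟨hj, h⟩, rfl⟩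
  rw [h, Set.ncard_image_of_injective _ fun x y hxy => (Prod.mk.inj hxy).1,
    Set.ncard_coe_finset]

lemma incompat_comm {U : Set (ℕ × ℕ)} {p q : ℕ × ℕ} : Incompat U p q ↔ Incompat U q p := by
  unfold Incompat
  rw [min_comm p.1, max_comm p.1, min_comm p.2, max_comm p.2, or_comm]

/-- In a nested region, a point is incompatible with a strictly northeast one iff the column of
the latter meets the row of the former. -/
lemma incompat_iff (hN : NestedRows b L R) {p q : ℕ × ℕ} (hp : p ∈ rowsRegion b L R)
    (hq : q ∈ rowsRegion b L R) (hlt : q.2 < p.2) :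
    Incompat (rowsRegion b L R) p q ↔ p.1 < q.1 ∧ q.1 ≤ R (b - p.2) := by
  obtain ⟨i, j⟩ := p
  obtain ⟨i', j'⟩ := q
  obtain ⟨hp1, hp2, hp3⟩ := hp
  obtain ⟨hq1, hq2, hq3⟩ := hq
  simp only at hp1 hp2 hp3 hq1 hq2 hq3 hlt
  constructor
  · rintro ⟨h1, h2⟩
    simp only at h1 h2
    have h3 : i < i' := by omega
    exact ⟨h3, (h2 i' j (by omega) (by omega) (by omega) (by omega)).2.2⟩
  · rintro ⟨h1, h2⟩
    simp only at h1 h2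
    refine ⟨Or.inl ⟨h1, hlt⟩, fun k l hk1 hk2 hl1 hl2 => ?_⟩
    simp only at hk1 hk2 hl1 hl2
    have h3 := hN.left_le (k := b - j) (h := b - l) (by omega) (by omega)
    have h4 := hN.right_le (k := b - j) (h := b - l) (by omega) (by omega)
    refine ⟨?_, ?_, ?_⟩ <;> simp only <;> omega

lemma pairwise_compat_iff (hN : NestedRows b L R) (hT : T ⊆ rowsRegion b L R) :
    T.Pairwise (Compat (rowsRegion b L R)) ↔
      ∀ p ∈ T, ∀ q ∈ T, q.2 < p.2 → p.1 < q.1 → R (b - p.2) < q.1 := by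
  constructor
  · intro h p hp q hq h1 h2
    by_contra! h3
    exact h hp hq (fun h => by simp [h] at h1)
      ((incompat_iff hN (hT hp) (hT hq) h1).2 ⟨h2, h3⟩)
  · intro h p hp q hq _ hinc
    rcases hinc.1 with h1 | h1
    · have h2 := (incompat_iff hN (hT hp) (hT hq) h1.2).1 hinc
      have := h p hp q hq h1.2 h1.1
      omega
    · have h2 := (incompat_iff hN (hT hq) (hT hp) h1.2).1 (incompat_comm.1 hinc)
      have := h q hq p hp h1.2 h1.1
      omega

lemma isUTree_iff_isTreeRows (hN : NestedRows b L R) (hT : T ⊆ rowsRegion b L R) :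
    IsUTree (rowsRegion b L R) T ↔ IsTreeRows b L R (rowsOf b L R T) := by
  constructor
  · rintro ⟨-, hpw, hmax⟩
    rw [pairwise_compat_iff hN hT] at hpw
    refine ⟨fun h _ => rowsOf_subset h, fun h hb q hq => ?_, fun h hb i hi hB hup => ?_⟩
    · rintro ⟨k, hk, p, hp, hpq, hqR⟩
      rw [mem_rowsOf hT hb] at hq
      rw [mem_rowsOf hT (by omega)] at hp
      have := hpw _ hp _ hq (by simp only; omega) hpq
      simp only [Nat.sub_sub_self (by omega : k ≤ b)] at this
      omega
    · have hmem : (i, b - h) ∈ rowsRegion b L R := by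
        refine ⟨Nat.sub_le _ _, ?_⟩
        simp only [Nat.sub_sub_self hb]
        exact Finset.mem_Icc.1 hi
      have hsub : insert (i, b - h) T ⊆ rowsRegion b L R := Set.insert_subset hmem hT
      rw [mem_rowsOf hT hb, ← hmax _ hsub ?_ (Set.subset_insert _ _)]
      · exact Set.mem_insert _ _
      rw [pairwise_compat_iff hN hsub]
      rintro p (rfl | hp) q (rfl | hq) h1 h2
      · omega
      · obtain ⟨i', j'⟩ := q
        simp only at h1 h2 ⊢
        rw [Nat.sub_sub_self hb]
        exact hup (b - j') (by omega) (by omega) i' ((mem_iff_mem_rowsOf hT).1 hq).2 h2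
      · obtain ⟨i', j'⟩ := p
        simp only at h1 h2 ⊢
        obtain ⟨h3, h4⟩ := (mem_iff_mem_rowsOf hT).1 hp
        by_contra! h5
        exact hB ⟨b - j', by omega, i', h4, h2, h5⟩
      · exact hpw p hp q hq h1 h2
  · intro hF
    refine ⟨hT, ?_, fun T' hT' hpw' hTT' => (Set.Subset.antisymm hTT' ?_).symm⟩
    · rw [pairwise_compat_iff hN hT]
      rintro ⟨i, j⟩ hp ⟨i', j'⟩ hq h1 h2
      simp only at h1 h2 ⊢
      rw [mem_iff_mem_rowsOf hT] at hp hq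
      by_contra! h3
      exact hF.not_blocked _ (Nat.sub_le _ _) _ hq.2 ⟨b - j, by omega, i, hp.2, h2, h3⟩
    · rw [pairwise_compat_iff hN hT'] at hpw'
      rintro ⟨i, j⟩ hp
      obtain ⟨h1, h2⟩ := hT' hp
      simp only at h1 h2
      refine (mem_iff_mem_rowsOf hT).2 ⟨h1, hF.maximal _ (Nat.sub_le _ _) i
        (Finset.mem_Icc.2 h2) ?_ fun k hk hkb q hq hlt => ?_⟩
      · rintro ⟨k, hk, p, hp', h3, h4⟩
        rw [mem_rowsOf hT (by omega)] at hp'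
        have := hpw' _ (hTT' hp') _ hp (by simp only; omega) h3
        simp only [Nat.sub_sub_self (by omega : k ≤ b)] at this
        omega
      · rw [mem_rowsOf hT hkb] at hq
        exact hpw' _ hp _ (hTT' hq) (by simp only; omega) hlt

lemma rowsOf_ofRows {F : ℕ → Finset ℕ} (hF : ∀ h ≤ b, F h ⊆ Finset.Icc (L h) (R h)) {h : ℕ}
    (hb : h ≤ b) : rowsOf b L R (ofRows b F) h = F h := by
  ext i
  rw [mem_rowsOf (ofRows_subset hF) hb]
  simp [ofRows, Nat.sub_sub_self hb]

lemma ofRows_congr {F G : ℕ → Finset ℕ} (h : ∀ k ≤ b, F k = G k) :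
    ofRows b F = ofRows b G := by
  ext p
  simp only [ofRows, Set.mem_ofPred_eq, h _ (Nat.sub_le b p.2)]

lemma IsTreeRows.congr {F G : ℕ → Finset ℕ} (hF : IsTreeRows b L R F)
    (h : ∀ k ≤ b, F k = G k) : IsTreeRows b L R G := by
  have hB : ∀ k ≤ b, ∀ i, Blocked R G k i → Blocked R F k i := by
    rintro k hk i ⟨m, hm, hp⟩
    exact ⟨m, hm, by rwa [h m (by omega)]⟩
  have hB' : ∀ k ≤ b, ∀ i, Blocked R F k i → Blocked R G k i := by
    rintro k hk i ⟨m, hm, hp⟩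
    exact ⟨m, hm, by rwa [← h m (by omega)]⟩
  refine ⟨fun k hk => h k hk ▸ hF.subset k hk, fun k hk q hq hb => ?_,
    fun k hk i hi hb hup => ?_⟩
  · exact hF.not_blocked k hk q (h k hk ▸ hq) (hB k hk q hb)
  · rw [← h k hk]
    refine hF.maximal k hk i hi (fun h' => hb (hB' k hk i h')) fun m hm hmb q hq => ?_
    exact hup m hm hmb q (h m hmb ▸ hq)

theorem existsUnique_isUTree (hN : NestedRows b L R) {μ : ℕ → ℕ}
    (hμ : ∀ k ≤ b, ∑ m ∈ Finset.range (k + 1), μ m + L k ≤ R k)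
    (htot : ∑ m ∈ Finset.range (b + 1), μ m + L b = R b) :
    ∃! T : Set (ℕ × ℕ), IsUTree (rowsRegion b L R) T ∧
      ∀ j, j ≤ b → {p ∈ T | p.2 = j}.ncard = μ (b - j) + 1 := by
  have hsub : ∀ h ≤ b, pathRow L R μ h ⊆ Finset.Icc (L h) (R h) := fun h _ => pathRow_subset h
  refine ⟨ofRows b (pathRow L R μ), ⟨?_, fun j hj => ?_⟩, fun T hT => ?_⟩
  · rw [isUTree_iff_isTreeRows hN (ofRows_subset hsub)]
    exact (isTreeRows_pathRow hN hμ htot).congr fun k hk => (rowsOf_ofRows hsub hk).symm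
  · rw [ncard_row (ofRows_subset hsub) hj, rowsOf_ofRows hsub (Nat.sub_le _ _)]
    exact card_pathRow hN hμ (Nat.sub_le _ _)
  · obtain ⟨hT, hcard⟩ := hT
    rw [← ofRows_rowsOf hT.1]
    have hcard' : ∀ h ≤ b, (rowsOf b L R T h).card = μ h + 1 := fun h hb => by
      have := hcard (b - h) (Nat.sub_le _ _)
      rwa [ncard_row hT.1 (Nat.sub_le _ _), Nat.sub_sub_self hb] at this
    exact ofRows_congr fun k hk =>
      (((isUTree_iff_isTreeRows hN hT.1).1 hT).eq_pathRow_and_sum_le hN hcard' k hk).1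

/-- The row sizes of a tree, diminished by one, form a lattice path. -/
lemma IsUTree.exists_path (hN : NestedRows b L R) (hT : IsUTree (rowsRegion b L R) T) :
    ∃ μ : ℕ → ℕ, (∀ i, b < i → μ i = 0) ∧
      (∀ k ≤ b, ∑ m ∈ Finset.range (k + 1), μ m + L k ≤ R k) ∧
      ∑ m ∈ Finset.range (b + 1), μ m + L b = R b ∧
      ∀ j, j ≤ b → {p ∈ T | p.2 = j}.ncard = μ (b - j) + 1 := by
  have hF := (isUTree_iff_isTreeRows hN hT.1).1 hT
  set μ : ℕ → ℕ := fun h => if h ≤ b then (rowsOf b L R T h).card - 1 else 0 with hμ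
  have hcard : ∀ h ≤ b, (rowsOf b L R T h).card = μ h + 1 := fun h hb => by
    have := (hF.nonempty hN hb).card_pos
    simp only [hμ, hb, if_true]
    omega
  refine ⟨μ, fun i hi => by simp [hμ, hi], fun k hk => (hF.eq_pathRow_and_sum_le hN hcard k hk).2,
    hF.sum_eq hN hcard, fun j hj => ?_⟩
  rw [ncard_row hT.1 hj, hcard _ (Nat.sub_le _ _)]

end Trees

/-! ### The stack set `U_{δ,ν}` -/

/-- The leftmost column of `U_{δ,ν}` at height `h`. -/
def leftColumn (b : ℕ) (ν δ : ℕ → ℕ) (h : ℕ) : ℕ :=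
  ∑ m ∈ Finset.Icc (h + 1) b, (ν m - δ m)

/-- The rightmost column of `U_{δ,ν}` at height `h`. -/
def rightColumn (b : ℕ) (ν δ : ℕ → ℕ) (h : ℕ) : ℕ :=
  (∑ m ∈ Finset.Icc 1 b, (ν m - δ m)) + ν 0 + ∑ m ∈ Finset.Icc 1 h, δ m

lemma sum_add_leftColumn {b : ℕ} {ν δ : ℕ → ℕ} (hδ : ∀ m, 1 ≤ m → m ≤ b → δ m ≤ ν m) {h : ℕ}
    (hb : h ≤ b) :
    ∑ i ∈ Finset.range (h + 1), ν i + leftColumn b ν δ h = rightColumn b ν δ h := by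
  induction h with
  | zero => simp [leftColumn, rightColumn, add_comm]
  | succ h ih =>
    have ih := ih (by omega)
    have h1 := hδ (h + 1) (by omega) hb
    unfold leftColumn rightColumn at *
    rw [← Finset.add_sum_Ioc_eq_sum_Icc (f := fun m => ν m - δ m) hb] at ih
    rw [Finset.sum_range_succ, Finset.sum_Icc_succ_top (by omega)]
    have h2 : Finset.Ioc (h + 1) b = Finset.Icc (h + 1 + 1) b := by
      ext
      simp only [Finset.mem_Ioc, Finset.mem_Icc]
      omega
    rw [h2] at ih
    omega

lemma nestedRows_stackSetDN {b : ℕ} {ν δ : ℕ → ℕ} (hδ : ∀ m, 1 ≤ m → m ≤ b → δ m ≤ ν m) :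
    NestedRows b (leftColumn b ν δ) (rightColumn b ν δ) where
  left_le hkh _ := Finset.sum_le_sum_of_subset (Finset.Icc_subset_Icc_left (by omega))
  right_le hkh _ := Nat.add_le_add_left
    (Finset.sum_le_sum_of_subset (Finset.Icc_subset_Icc_right hkh)) _
  left_le_right hb := by
    have := sum_add_leftColumn hδ hb
    omega

lemma isNuPath_iff {b : ℕ} {ν δ : ℕ → ℕ} (hδ : ∀ m, 1 ≤ m → m ≤ b → δ m ≤ ν m) (μ : ℕ → ℕ) :
    IsNuPath b ν μ ↔
      (∀ k ≤ b, ∑ m ∈ Finset.range (k + 1), μ m + leftColumn b ν δ k ≤ rightColumn b ν δ k) ∧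
      ∑ m ∈ Finset.range (b + 1), μ m + leftColumn b ν δ b = rightColumn b ν δ b := by
  refine and_congr (forall₂_congr fun k hk => ?_) ?_
  · rw [← sum_add_leftColumn hδ hk, Nat.add_le_add_iff_right]
  · rw [← sum_add_leftColumn hδ le_rfl, Nat.add_right_cancel_iff]

/-- For every `ν`-path `μ` there is exactly one `U_{δ,ν}`-tree having,
for each `j ∈ {0,…,b}`, exactly `μ (b − j) + 1` elements in row `j`.  Consequently, the
set of `ν`-paths and the set of `U_{δ,ν}`-trees are in bijection and have the same
cardinality. -/
theorem nu_path_utree_bijection (b : ℕ) (hb : 1 ≤ b) (ν δ : ℕ → ℕ)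
    (hδ : ∀ m, 1 ≤ m → m ≤ b → δ m ≤ ν m)
    (μ : ℕ → ℕ) (hμ : IsNuPath b ν μ) :
    (∃! T : Set (ℕ × ℕ), IsUTree (stackSetDN b ν δ) T ∧
        ∀ j, j ≤ b → {p ∈ T | p.2 = j}.ncard = μ (b - j) + 1) ∧
    Nat.card {μ' : ℕ → ℕ // IsNuPath b ν μ' ∧ ∀ i, b < i → μ' i = 0} =
      Nat.card {T : Set (ℕ × ℕ) // IsUTree (stackSetDN b ν δ) T} := by
  have hN := nestedRows_stackSetDN hδ
  have key : ∀ μ' : ℕ → ℕ, IsNuPath b ν μ' →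
      ∃! T : Set (ℕ × ℕ), IsUTree (stackSetDN b ν δ) T ∧
        ∀ j, j ≤ b → {p ∈ T | p.2 = j}.ncard = μ' (b - j) + 1 := fun μ' h =>
    existsUnique_isUTree hN ((isNuPath_iff hδ μ').1 h).1 ((isNuPath_iff hδ μ').1 h).2
  refine ⟨key μ hμ, ?_⟩
  choose! tree htree huniq using key
  refine Nat.card_eq_of_bijective
    (fun μ' : {μ' : ℕ → ℕ // IsNuPath b ν μ' ∧ ∀ i, b < i → μ' i = 0} =>
      (⟨tree μ'.1, (htree μ'.1 μ'.2.1).1⟩ : {T // IsUTree (stackSetDN b ν δ) T})) ⟨?_, ?_⟩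
  · rintro ⟨μ₁, h₁, hz₁⟩ ⟨μ₂, h₂, hz₂⟩ heq
    have heq : tree μ₁ = tree μ₂ := congrArg Subtype.val heq
    refine Subtype.ext (funext fun i => ?_)
    rcases le_or_gt i b with hi | hi
    · have e₁ := (htree μ₁ h₁).2 (b - i) (Nat.sub_le _ _)
      have e₂ := (htree μ₂ h₂).2 (b - i) (Nat.sub_le _ _)
      rw [Nat.sub_sub_self hi] at e₁ e₂
      rw [heq, e₂] at e₁
      exact (Nat.succ_injective e₁).symm
    · exact (hz₁ i hi).trans (hz₂ i hi).symm
  · rintro ⟨T, hT⟩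
    obtain ⟨μ', hz, hle, htot, hcard⟩ := IsUTree.exists_path hN hT
    have hμ' : IsNuPath b ν μ' := (isNuPath_iff hδ μ').2 ⟨hle, htot⟩
    exact ⟨⟨μ', hμ', hz⟩, Subtype.ext (huniq μ' hμ' T ⟨hT, hcard⟩).symm⟩
end

section
/- Let μ be a ν-path and let p be a valley of μ. Then there exists a lattice point q of μ strictly after p with alt_δ(q) = alt_δ(p). Moreover, taking q to be the first such point, the lattice path μ' obtained from μ by exchanging the east step immediately preceding p with the subpath of μ from p to q is again a ν-path (so the δ-rotation of μ at any valley is well defined and yields a ν-path). -/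
/-- The set of lattice points of the monotone lattice path `μ` (with `μ i` east steps at
height `i`): the point `(x, y)` lies on `μ` iff `y ≤ b` and `μ_0 + ⋯ + μ_{y-1} ≤ x ≤
μ_0 + ⋯ + μ_y`. -/
def latticePts (b : ℕ) (μ : ℕ → ℕ) : Set (ℕ × ℕ) :=
  {p | p.2 ≤ b ∧ (∑ i ∈ Finset.range p.2, μ i) ≤ p.1 ∧
    p.1 ≤ ∑ i ∈ Finset.range (p.2 + 1), μ i}

/-- The `δ`-altitude of a lattice point `(x, y)`: `(δ_1 + ⋯ + δ_y) − x`. -/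
def altOf (δ : ℕ → ℕ) (p : ℕ × ℕ) : ℤ :=
  (∑ m ∈ Finset.Icc 1 p.2, (δ m : ℤ)) - (p.1 : ℤ)

/-- `q` comes strictly after `p` along a monotone (north/east) lattice path. -/
def PathAfter (p q : ℕ × ℕ) : Prop := p.1 ≤ q.1 ∧ p.2 ≤ q.2 ∧ p ≠ q

/-- Moving one east step of `μ` from height `y` to height `k` changes the partial sums of `μ`
exactly at the indices separating `y` from `k`. -/
theorem sum_range_move_step (μ : ℕ → ℕ) {y k : ℕ} (hyk : y ≠ k) (hvalley : 1 ≤ μ y) (n : ℕ) :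
    ∑ i ∈ Finset.range n, (if i = y then μ i - 1 else if i = k then μ i + 1 else μ i) +
        (if y < n then 1 else 0) =
      ∑ i ∈ Finset.range n, μ i + (if k < n then 1 else 0) := by
  induction n with
  | zero => simp
  | succ n ih =>
    rw [Finset.sum_range_succ, Finset.sum_range_succ]
    by_cases h : n = y
    · subst h
      split_ifs at ih ⊢ <;> omega
    · split_ifs at ih ⊢ <;> omega

/-- Moving one east step of a `ν`-path to a greater height yields a `ν`-path. -/
theorem IsNuPath.move_step {b : ℕ} {ν μ : ℕ → ℕ} (hμ : IsNuPath b ν μ) {y k : ℕ}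
    (hyk : y < k) (hk : k ≤ b) (hvalley : 1 ≤ μ y) :
    IsNuPath b ν (fun i => if i = y then μ i - 1 else if i = k then μ i + 1 else μ i) := by
  have h := sum_range_move_step μ hyk.ne hvalley
  refine ⟨fun j hj => ?_, ?_⟩
  · beta_reduce
    have h₁ := h (j + 1)
    have h₂ := hμ.1 j hj
    split_ifs at h₁ <;> omega
  · beta_reduce
    have h₁ := h (b + 1)
    have h₂ := hμ.2
    split_ifs at h₁ <;> omega

/-- The end point of each tail of a `ν`-path has at most the altitude of its starting point. -/
theorem IsNuPath.sum_add_sum_le {b : ℕ} {ν δ μ : ℕ → ℕ}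
    (hδ : ∀ m, 1 ≤ m → m ≤ b → δ m ≤ ν m) (hμ : IsNuPath b ν μ) {y : ℕ} (hy : y ≤ b) :
    ∑ m ∈ Finset.Icc 1 b, δ m + ∑ i ∈ Finset.range (y + 1), μ i ≤
      ∑ m ∈ Finset.Icc 1 y, δ m + ∑ i ∈ Finset.range (b + 1), μ i := by
  have key : ∀ k, y ≤ k → k ≤ b →
      ∑ m ∈ Finset.Icc 1 k, δ m + ∑ i ∈ Finset.range (y + 1), ν i ≤
        ∑ m ∈ Finset.Icc 1 y, δ m + ∑ i ∈ Finset.range (k + 1), ν i := by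
    intro k hk
    induction k, hk using Nat.le_induction with
    | base => exact fun _ => le_rfl
    | succ k hk ih =>
      intro hkb
      have h₁ := ih (by omega)
      have h₂ := hδ (k + 1) (by omega) hkb
      rw [Finset.sum_Icc_succ_top (by omega), Finset.sum_range_succ _ (k + 1)]
      omega
  have h₁ := key b hy le_rfl
  have h₂ := hμ.1 y hy
  have h₃ := hμ.2
  omega

/-- A lattice path whose end point has at most the altitude of the last point `p` at height `y`
has a lattice point at a height greater than `y` with the altitude of `p`. -/
theorem exists_altOf_eq {b : ℕ} (δ μ : ℕ → ℕ) {y : ℕ} (hy : y < b)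
    (hend : ∑ m ∈ Finset.Icc 1 b, δ m + ∑ i ∈ Finset.range (y + 1), μ i ≤
      ∑ m ∈ Finset.Icc 1 y, δ m + ∑ i ∈ Finset.range (b + 1), μ i) :
    ∃ q ∈ latticePts b μ, y < q.2 ∧
      altOf δ q = altOf δ (∑ i ∈ Finset.range (y + 1), μ i, y) := by
  classical
  have hex : ∃ k, y < k ∧ ∑ m ∈ Finset.Icc 1 k, δ m + ∑ i ∈ Finset.range (y + 1), μ i ≤
      ∑ m ∈ Finset.Icc 1 y, δ m + ∑ i ∈ Finset.range (k + 1), μ i := ⟨b, hy, hend⟩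
  obtain ⟨hyk, hle⟩ := Nat.find_spec hex
  have hkb : Nat.find hex ≤ b := Nat.find_min' hex ⟨hy, hend⟩
  have hmin := fun m => Nat.find_min hex (m := m)
  generalize Nat.find hex = k at hyk hle hkb hmin
  obtain ⟨j, rfl⟩ : ∃ j, k = j + 1 := ⟨k - 1, by omega⟩
  have hδ : ∑ m ∈ Finset.Icc 1 (j + 1), δ m = ∑ m ∈ Finset.Icc 1 j, δ m + δ (j + 1) :=
    Finset.sum_Icc_succ_top (by omega) _
  have hmono : ∑ m ∈ Finset.Icc 1 y, δ m ≤ ∑ m ∈ Finset.Icc 1 (j + 1), δ m :=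
    Finset.sum_le_sum_of_subset (Finset.Icc_subset_Icc_right hyk.le)
  have hstart : ∑ m ∈ Finset.Icc 1 y, δ m + ∑ i ∈ Finset.range (j + 1), μ i ≤
      ∑ m ∈ Finset.Icc 1 j, δ m + ∑ i ∈ Finset.range (y + 1), μ i := by
    rcases (Nat.lt_succ_iff.mp hyk).eq_or_lt with rfl | hyj
    · exact le_rfl
    · have := hmin j (Nat.lt_succ_self j)
      omega
  refine ⟨(∑ m ∈ Finset.Icc 1 (j + 1), δ m + ∑ i ∈ Finset.range (y + 1), μ i -
    ∑ m ∈ Finset.Icc 1 y, δ m, j + 1), ⟨hkb, ?_, ?_⟩, hyk, ?_⟩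
  · dsimp only
    omega
  · dsimp only
    omega
  · simp only [altOf, ← Nat.cast_sum]
    omega

/-- Let `μ` be a `ν`-path and `p` a valley of `μ` (at height `y < b`, with
`μ y ≥ 1`, so `p = (μ_0 + ⋯ + μ_y, y)` is preceded by an east step and followed by a north
step).  Then some lattice point of `μ` strictly after `p` has the same `δ`-altitude as `p`;
moreover, for the first such point `q`, the path `μ'` obtained from `μ` by exchanging the
east step preceding `p` with the subpath of `μ` from `p` to `q` — so that `μ'` has one east
step fewer at height `y` and one more at the height of `q` — is again a `ν`-path. -/
theorem delta_rotation_well_defined (b : ℕ) (hb : 1 ≤ b) (ν δ : ℕ → ℕ)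
    (hδ : ∀ m, 1 ≤ m → m ≤ b → δ m ≤ ν m)
    (μ : ℕ → ℕ) (hμ : IsNuPath b ν μ)
    (y : ℕ) (hy : y < b) (hvalley : 1 ≤ μ y) :
    (∃ q ∈ latticePts b μ, PathAfter (∑ i ∈ Finset.range (y + 1), μ i, y) q ∧
        altOf δ q = altOf δ (∑ i ∈ Finset.range (y + 1), μ i, y)) ∧
    ∀ q ∈ latticePts b μ,
      PathAfter (∑ i ∈ Finset.range (y + 1), μ i, y) q →
      altOf δ q = altOf δ (∑ i ∈ Finset.range (y + 1), μ i, y) →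
      (∀ q' ∈ latticePts b μ, PathAfter (∑ i ∈ Finset.range (y + 1), μ i, y) q' →
        altOf δ q' = altOf δ (∑ i ∈ Finset.range (y + 1), μ i, y) →
        q.1 ≤ q'.1 ∧ q.2 ≤ q'.2) →
      IsNuPath b ν (fun i => if i = y then μ i - 1 else if i = q.2 then μ i + 1 else μ i) := by
  constructor
  · obtain ⟨q, hq, hyq, halt⟩ := exists_altOf_eq δ μ hy (hμ.sum_add_sum_le hδ hy.le)
    refine ⟨q, hq, ⟨?_, hyq.le, fun h => hyq.ne (congrArg Prod.snd h)⟩, halt⟩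
    exact (Finset.sum_le_sum_of_subset (Finset.range_subset_range.mpr hyq)).trans hq.2.1
  · rintro ⟨x, k⟩ ⟨hkb, -, hx⟩ ⟨hle, hyk, hne⟩ - -
    refine hμ.move_step (lt_of_le_of_ne hyk ?_) hkb hvalley
    rintro rfl
    exact hne (Prod.ext (le_antisymm hle hx) rfl)
end

section
/- Let δ and δ' be increment vectors with respect to ν, and let u = (u_0,…,u_a) and u' = (u'_0,…,u'_a) be the column-height sequences of the stack sets U = U_{δ,ν} and U' = U_{δ',ν}. Then there exists a permutation σ of {0,…,a} with u'_{σ(i)} = u_i for all i; for any such σ one has (i,j) ∈ U ⟺ (σ(i), j) ∈ U', and consequently the linear map L : ℝ^{a+1} × ℝ^{b+1} → ℝ^{a+1} × ℝ^{b+1} determined by L(e_i, 0) = (e_{σ(i)}, 0) and L(0, e_j) = (0, e_j) maps the polytope conv{(e_i, e_j) : (i,j) ∈ U} onto conv{(e_i, e_j) : (i,j) ∈ U'}. -/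
/-- The vertex `(e_i, e_j)` of `Δ_a × Δ_b ⊆ ℝ^{a+1} × ℝ^{b+1}` associated to the
lattice point `p = (i, j)`. -/
noncomputable def embedPt (a b : ℕ) (p : ℕ × ℕ) :
    (Fin (a + 1) → ℝ) × (Fin (b + 1) → ℝ) :=
  (fun i => if (i : ℕ) = p.1 then 1 else 0, fun j => if (j : ℕ) = p.2 then 1 else 0)

/-- The height of column `i` of `U`: the number of points of `U` in column `i`. -/
noncomputable def colHeight (U : Set (ℕ × ℕ)) (i : ℕ) : ℕ :=
  {j : ℕ | (i, j) ∈ U}.ncard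

theorem sum_Icc_one_add_sum_Icc_succ (f : ℕ → ℕ) {k b : ℕ} (hk : k ≤ b) :
    ∑ m ∈ Finset.Icc 1 k, f m + ∑ m ∈ Finset.Icc (k + 1) b, f m = ∑ m ∈ Finset.Icc 1 b, f m := by
  have h := Finset.sum_Ioc_consecutive f (Nat.zero_le k) hk
  simpa [← Finset.Icc_succ_left_eq_Ioc] using h

theorem sum_Icc_sub_add_sum_Icc {b k : ℕ} {ν δ : ℕ → ℕ} (hδ : ∀ m, 1 ≤ m → m ≤ b → δ m ≤ ν m)
    (hk : k ≤ b) :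
    ∑ m ∈ Finset.Icc 1 k, (ν m - δ m) + ∑ m ∈ Finset.Icc 1 k, δ m =
      ∑ m ∈ Finset.Icc 1 k, ν m := by
  rw [← Finset.sum_add_distrib]
  refine Finset.sum_congr rfl fun m hm => ?_
  rw [Finset.mem_Icc] at hm
  exact Nat.sub_add_cancel (hδ m hm.1 (hm.2.trans hk))

theorem sum_range_succ_eq_add_sum_Icc (f : ℕ → ℕ) (b : ℕ) :
    ∑ i ∈ Finset.range (b + 1), f i = f 0 + ∑ m ∈ Finset.Icc 1 b, f m := by
  rw [Finset.sum_range_succ', add_comm, Finset.range_eq_Ico, Finset.sum_Ico_add' f 0 b 1]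
  rfl

/-- Columns of a stack set are closed under moving to a smaller row index. -/
theorem mem_stackSetDN_of_le {b i j k : ℕ} {ν δ : ℕ → ℕ} (h : (i, j) ∈ stackSetDN b ν δ)
    (hkj : k ≤ j) : (i, k) ∈ stackSetDN b ν δ := by
  obtain ⟨h1, h2, h3⟩ := h
  refine ⟨hkj.trans h1, le_trans ?_ h2, h3.trans ?_⟩
  · exact Finset.sum_le_sum_of_subset (Finset.Icc_subset_Icc (by grind) le_rfl)
  · exact Nat.add_le_add_left
      (Finset.sum_le_sum_of_subset (Finset.Icc_subset_Icc le_rfl (by grind))) _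

theorem mem_stackSetDN_iff_lt_colHeight {b i j : ℕ} {ν δ : ℕ → ℕ} :
    (i, j) ∈ stackSetDN b ν δ ↔ j < colHeight (stackSetDN b ν δ) i := by
  classical
  have hex : ∃ n, (i, n) ∉ stackSetDN b ν δ := ⟨b + 1, fun h => by have := h.1; simp at this⟩
  have hiff : ∀ n, (i, n) ∈ stackSetDN b ν δ ↔ n < Nat.find hex := fun n =>
    ⟨fun h => lt_of_not_ge fun hn => Nat.find_spec hex (mem_stackSetDN_of_le h hn),
      fun h => not_not.1 (Nat.find_min hex h)⟩
  have hcol : colHeight (stackSetDN b ν δ) i = Nat.find hex := by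
    have : {n : ℕ | (i, n) ∈ stackSetDN b ν δ} = (Finset.range (Nat.find hex) : Set ℕ) := by
      ext n
      simp only [Set.mem_ofPred_eq, Finset.coe_range, Set.mem_Iio]
      exact hiff n
    rw [colHeight, this, Set.ncard_coe_finset, Finset.card_range]
  rw [hcol, hiff]

theorem le_of_mem_stackSetDN {b : ℕ} {ν δ : ℕ → ℕ} (hδ : ∀ m, 1 ≤ m → m ≤ b → δ m ≤ ν m)
    {p : ℕ × ℕ} (hp : p ∈ stackSetDN b ν δ) : p.1 ≤ ∑ i ∈ Finset.range (b + 1), ν i := by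
  have h := (mem_stackSetDN_of_le (i := p.1) hp (Nat.zero_le p.2)).2.2
  have h1 := sum_Icc_sub_add_sum_Icc hδ le_rfl
  rw [sum_range_succ_eq_add_sum_Icc]
  simp only [Nat.sub_zero] at h
  omega

/-- Row `j` of a stack set has `1 + ν_0 + ⋯ + ν_{b-j}` points, whatever the increment vector. -/
theorem card_row_stackSetDN {b a j : ℕ} {ν δ : ℕ → ℕ} (hδ : ∀ m, 1 ≤ m → m ≤ b → δ m ≤ ν m)
    (ha : a = ∑ i ∈ Finset.range (b + 1), ν i) (hj : j ≤ b) :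
    Nat.card {i : Fin (a + 1) // ((i : ℕ), j) ∈ stackSetDN b ν δ} =
      ∑ i ∈ Finset.range (b - j + 1), ν i + 1 := by
  have e : {i : Fin (a + 1) // ((i : ℕ), j) ∈ stackSetDN b ν δ} ≃
      {i : ℕ // i ∈ Finset.Icc (∑ m ∈ Finset.Icc (b - j + 1) b, (ν m - δ m))
        ((∑ m ∈ Finset.Icc 1 b, (ν m - δ m)) + ν 0 + ∑ m ∈ Finset.Icc 1 (b - j), δ m)} :=
    { toFun := fun i => ⟨i.1, Finset.mem_Icc.2 i.2.2⟩
      invFun := fun i =>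
        have hi : ((i : ℕ), j) ∈ stackSetDN b ν δ := ⟨hj, Finset.mem_Icc.1 i.2⟩
        ⟨⟨i.1, Nat.lt_succ_of_le (ha ▸ le_of_mem_stackSetDN hδ hi)⟩, hi⟩
      left_inv := fun _ => rfl
      right_inv := fun _ => rfl }
  rw [Nat.card_congr e, Nat.card_eq_fintype_card, Fintype.card_coe, Nat.card_Icc,
    sum_range_succ_eq_add_sum_Icc]
  have h1 := sum_Icc_one_add_sum_Icc_succ (fun m => ν m - δ m) (Nat.sub_le b j)
  have h2 := sum_Icc_sub_add_sum_Icc hδ (Nat.sub_le b j)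
  omega

/-- Two `ℕ`-valued functions on a finite type whose superlevel sets have the same sizes
differ by a permutation. -/
theorem exists_perm_of_card_lt_eq {α : Type*} [Finite α] {f g : α → ℕ}
    (h : ∀ n, Nat.card {x // n < f x} = Nat.card {x // n < g x}) :
    ∃ σ : Equiv.Perm α, ∀ x, g (σ x) = f x := by
  classical
  have := Fintype.ofFinite α
  have key : ∀ (φ : α → ℕ) (n : ℕ), Nat.card {x // n ≤ φ x} =
      Nat.card {x // φ x = n} + Nat.card {x // n < φ x} := fun φ n => by
    simp only [Nat.card_eq_fintype_card, Fintype.card_subtype]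
    rw [← Finset.card_union_of_disjoint
      (Finset.disjoint_filter.2 fun x _ h1 h2 => by omega), ← Finset.filter_or]
    congr 1
    ext x
    simp only [Finset.mem_filter, Finset.mem_univ, true_and]
    omega
  have hle : ∀ n, Nat.card {x // n ≤ f x} = Nat.card {x // n ≤ g x} := by
    rintro (_ | n)
    · simp
    · exact h n
  have hfib : ∀ n, Nat.card {x // f x = n} = Nat.card {x // g x = n} := fun n => by
    have h1 := key f n
    have h2 := key g n
    have h3 := h n
    have h4 := hle n
    omega
  exact ⟨Equiv.ofFiberEquiv fun n => (Finite.card_eq.1 (hfib n)).some, fun x => Equiv.ofFiberEquiv_map _ x⟩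

theorem embedPt_val (a b : ℕ) (i : Fin (a + 1)) (j : Fin (b + 1)) :
    embedPt a b ((i : ℕ), (j : ℕ)) = (Pi.single i 1, 0) + (0, Pi.single j 1) := by
  ext k <;> simp [embedPt, Pi.single_apply, Fin.ext_iff]

/-- Let `δ` and `δ'` be increment vectors with respect to `ν` and let
`u`, `u'` be the column-height sequences of `U = U_{δ,ν}` and `U' = U_{δ',ν}`.  There is a
permutation `σ` of `{0,…,a}` with `u'_{σ(i)} = u_i` for all `i`; for any such `σ` one has
`(i,j) ∈ U ⟺ (σ i, j) ∈ U'`, and consequently the linear map `L` of `ℝ^{a+1} × ℝ^{b+1}`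
determined by `L (e_i, 0) = (e_{σ i}, 0)` and `L (0, e_j) = (0, e_j)` maps the polytope
`conv {(e_i, e_j) : (i,j) ∈ U}` onto `conv {(e_i, e_j) : (i,j) ∈ U'}`. -/
theorem stack_set_column_permutation (b : ℕ) (hb : 1 ≤ b) (ν δ δ' : ℕ → ℕ)
    (hδ : ∀ m, 1 ≤ m → m ≤ b → δ m ≤ ν m)
    (hδ' : ∀ m, 1 ≤ m → m ≤ b → δ' m ≤ ν m)
    (a : ℕ) (ha : a = ∑ i ∈ Finset.range (b + 1), ν i) :
    (∃ σ : Equiv.Perm (Fin (a + 1)), ∀ i : Fin (a + 1),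
        colHeight (stackSetDN b ν δ') ((σ i : ℕ)) = colHeight (stackSetDN b ν δ) ((i : ℕ))) ∧
    ∀ σ : Equiv.Perm (Fin (a + 1)),
      (∀ i : Fin (a + 1),
          colHeight (stackSetDN b ν δ') ((σ i : ℕ)) = colHeight (stackSetDN b ν δ) ((i : ℕ))) →
      ((∀ (i : Fin (a + 1)) (j : ℕ),
          ((i : ℕ), j) ∈ stackSetDN b ν δ ↔ ((σ i : ℕ), j) ∈ stackSetDN b ν δ') ∧
        ∀ L : ((Fin (a + 1) → ℝ) × (Fin (b + 1) → ℝ)) →ₗ[ℝ]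
            ((Fin (a + 1) → ℝ) × (Fin (b + 1) → ℝ)),
          (∀ i : Fin (a + 1), L (Pi.single i 1, 0) = (Pi.single (σ i) 1, 0)) →
          (∀ j : Fin (b + 1), L (0, Pi.single j 1) = (0, Pi.single j 1)) →
          L '' convexHull ℝ (embedPt a b '' stackSetDN b ν δ) =
            convexHull ℝ (embedPt a b '' stackSetDN b ν δ')) := by
  refine ⟨exists_perm_of_card_lt_eq (f := fun i : Fin (a + 1) => colHeight (stackSetDN b ν δ) i)
    (g := fun i => colHeight (stackSetDN b ν δ') i) fun j => ?_, fun σ hσ => ?_⟩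
  · simp only [← mem_stackSetDN_iff_lt_colHeight]
    rcases le_or_gt j b with hj | hj
    · rw [card_row_stackSetDN hδ ha hj, card_row_stackSetDN hδ' ha hj]
    · have hempty : ∀ (ε : ℕ → ℕ) (i : ℕ), (i, j) ∉ stackSetDN b ν ε :=
        fun ε i h => absurd h.1 (not_le.2 hj)
      simp [hempty]
  have hmem : ∀ (i : Fin (a + 1)) (j : ℕ),
      ((i : ℕ), j) ∈ stackSetDN b ν δ ↔ ((σ i : ℕ), j) ∈ stackSetDN b ν δ' := fun i j => by
    rw [mem_stackSetDN_iff_lt_colHeight, mem_stackSetDN_iff_lt_colHeight, hσ]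
  refine ⟨hmem, fun L hL₁ hL₂ => ?_⟩
  have hL : ∀ (i : Fin (a + 1)) (j : Fin (b + 1)),
      L (embedPt a b ((i : ℕ), (j : ℕ))) = embedPt a b ((σ i : ℕ), (j : ℕ)) := fun i j => by
    rw [embedPt_val, embedPt_val, map_add, hL₁, hL₂]
  rw [LinearMap.image_convexHull]
  congr 1
  ext x
  constructor
  · rintro ⟨_, ⟨⟨i, j⟩, hp, rfl⟩, rfl⟩
    have hi : i < a + 1 := Nat.lt_succ_of_le (ha ▸ le_of_mem_stackSetDN hδ hp)
    have hj : j < b + 1 := Nat.lt_succ_of_le hp.1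
    exact ⟨_, (hmem ⟨i, hi⟩ j).1 hp, (hL ⟨i, hi⟩ ⟨j, hj⟩).symm⟩
  · rintro ⟨⟨i, j⟩, hp, rfl⟩
    have hi : i < a + 1 := Nat.lt_succ_of_le (ha ▸ le_of_mem_stackSetDN hδ' hp)
    have hj : j < b + 1 := Nat.lt_succ_of_le hp.1
    have hσi : σ (σ.symm ⟨i, hi⟩) = ⟨i, hi⟩ := σ.apply_symm_apply _
    refine ⟨_, ⟨((σ.symm ⟨i, hi⟩ : Fin (a + 1)), j), (hmem _ j).2 ?_, rfl⟩, ?_⟩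
    · rwa [hσi]
    · exact (hL _ ⟨j, hj⟩).trans (by rw [hσi])
end

section
/- The polytope 𝒰_U = conv{(e_i, e_j) : (i,j) ∈ U} ⊆ ℝ^{a+1} × ℝ^{b+1} is the union, over all U-trees T, of the simplices conv{(e_i, e_j) : (i,j) ∈ T}. -/
/-- Among the ways of writing a point of the convex hull of a finite family as a convex
combination, one maximizes a given linear functional of the weights. -/
theorem exists_stdSimplex_weights_maximal {ι E : Type*} [Fintype ι] [AddCommGroup E] [Module ℝ E]
    [TopologicalSpace E] [T2Space E] [IsTopologicalAddGroup E] [ContinuousSMul ℝ E]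
    (v : ι → E) (c : ι → ℝ) {x : E} (hx : x ∈ convexHull ℝ (Set.range v)) :
    ∃ w ∈ stdSimplex ℝ ι, ∑ i, w i • v i = x ∧
      ∀ w' ∈ stdSimplex ℝ ι, ∑ i, w' i • v i = x → ∑ i, w' i * c i ≤ ∑ i, w i * c i := by
  have hcomp : IsCompact (stdSimplex ℝ ι ∩ {w | ∑ i, w i • v i = x}) :=
    (isCompact_stdSimplex ℝ ι).inter_right (isClosed_eq (by fun_prop) continuous_const)
  have hne : (stdSimplex ℝ ι ∩ {w | ∑ i, w i • v i = x}).Nonempty := by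
    obtain ⟨κ, _, w, z, hw0, hw1, hz, hxz⟩ := mem_convexHull_iff_exists_fintype.1 hx
    choose f hf using hz
    classical
    refine ⟨fun i => ∑ k with f k = i, w k, ⟨fun i => Finset.sum_nonneg fun k _ => hw0 k, ?_⟩, ?_⟩
    · exact (Finset.sum_fiberwise Finset.univ f w).trans hw1
    · rw [Set.mem_ofPred_eq, ← hxz, ← Finset.sum_fiberwise Finset.univ f]
      refine Finset.sum_congr rfl fun i _ => ?_
      rw [Finset.sum_smul]
      refine Finset.sum_congr rfl fun k hk => ?_
      rw [← hf k, (Finset.mem_filter.1 hk).2]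
  obtain ⟨w, ⟨hw, hwx⟩, hmax⟩ := hcomp.exists_isMaxOn hne
    (f := fun w => ∑ i, w i * c i) (by fun_prop)
  exact ⟨w, hw, hwx, fun w' hw' hx' => hmax ⟨hw', hx'⟩⟩

/-- Exchanging two vectors of positive weight for two others with the same sum cannot increase
the maximized functional. -/
theorem add_le_add_of_stdSimplex_weights_maximal {ι E : Type*} [Fintype ι] [AddCommGroup E]
    [Module ℝ E] {v : ι → E} {c : ι → ℝ} {w : ι → ℝ} (hw : w ∈ stdSimplex ℝ ι)
    (hmax : ∀ w' ∈ stdSimplex ℝ ι, ∑ i, w' i • v i = ∑ i, w i • v i →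
      ∑ i, w' i * c i ≤ ∑ i, w i * c i)
    {p q r s : ι} (hpq : p ≠ q) (hp : w p ≠ 0) (hq : w q ≠ 0) (hv : v p + v q = v r + v s) :
    c r + c s ≤ c p + c q := by
  classical
  have hp' : 0 < w p := lt_of_le_of_ne (hw.1 p) hp.symm
  have hq' : 0 < w q := lt_of_le_of_ne (hw.1 q) hq.symm
  obtain ⟨ε, hε, hεp, hεq⟩ : ∃ ε > 0, ε ≤ w p ∧ ε ≤ w q :=
    ⟨min (w p) (w q), lt_min hp' hq', min_le_left _ _, min_le_right _ _⟩
  let w' : ι → ℝ := fun i => w i + (if i = r then ε else 0) + (if i = s then ε else 0)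
    - (if i = p then ε else 0) - (if i = q then ε else 0)
  have key := hmax w' ⟨fun i => ?_, ?_⟩ ?_
  · simp only [w', add_mul, sub_mul, ite_mul, zero_mul, Finset.sum_add_distrib,
      Finset.sum_sub_distrib, Finset.sum_ite_eq', Finset.mem_univ, if_true] at key
    nlinarith
  · have h0 := hw.1 i
    have hr : 0 ≤ if i = r then ε else 0 := by split_ifs <;> linarith
    have hs : 0 ≤ if i = s then ε else 0 := by split_ifs <;> linarith
    simp only [w']
    by_cases h1 : i = p
    · subst h1
      simp only [if_true, if_neg hpq]
      linarith
    · by_cases h2 : i = q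
      · subst h2
        simp only [if_true, if_neg h1]
        linarith
      · simp only [if_neg h1, if_neg h2]
        linarith
  · simp [w', Finset.sum_add_distrib, Finset.sum_sub_distrib, hw.2]
  · simp only [w', add_smul, sub_smul, ite_smul, zero_smul, Finset.sum_add_distrib,
      Finset.sum_sub_distrib, Finset.sum_ite_eq', Finset.mem_univ, if_true]
    rw [add_assoc, ← smul_add, ← hv, smul_add]
    abel

theorem stackSet_finite (a : ℕ) (u : ℕ → ℕ) : (stackSet a u).Finite := by
  refine ((Set.finite_Iic a).biUnion fun i _ =>
    (Set.finite_Iio (u i)).image (Prod.mk i)).subset fun p hp => ?_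
  exact Set.mem_biUnion hp.1 ⟨p.2, hp.2, rfl⟩

/-- A pairwise compatible subset of a finite set `U` extends to a `U`-tree. -/
theorem exists_isUTree_superset {U S : Set (ℕ × ℕ)} (hU : U.Finite) (hSU : S ⊆ U)
    (hS : S.Pairwise (Compat U)) : ∃ T, IsUTree U T ∧ S ⊆ T := by
  have hfin : {T | T ⊆ U ∧ T.Pairwise (Compat U)}.Finite :=
    hU.finite_subsets.subset fun T hT => hT.1
  obtain ⟨T, hST, hT⟩ := hfin.exists_le_maximal (a := S) ⟨hSU, hS⟩
  exact ⟨T, ⟨hT.prop.1, hT.prop.2, fun T' h1 h2 h => (hT.eq_of_le ⟨h1, h2⟩ h).symm⟩, hST⟩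

theorem embedPt_add_embedPt (a b i j k l : ℕ) :
    embedPt a b (i, j) + embedPt a b (k, l) = embedPt a b (i, l) + embedPt a b (k, j) := by
  simp only [embedPt, Prod.mk_add_mk, Prod.mk.injEq, true_and]
  exact add_comm _ _

/-- A point of `conv {(e_i, e_j) : (i,j) ∈ U}` lies over a pairwise compatible subset of `U`. -/
theorem exists_compat_subset_of_mem_convexHull {a b : ℕ} {U : Set (ℕ × ℕ)} (hU : U.Finite)
    {x : (Fin (a + 1) → ℝ) × (Fin (b + 1) → ℝ)} (hx : x ∈ convexHull ℝ (embedPt a b '' U)) :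
    ∃ S ⊆ U, S.Pairwise (Compat U) ∧ x ∈ convexHull ℝ (embedPt a b '' S) := by
  have := hU.fintype
  rw [Set.image_eq_range] at hx
  obtain ⟨w, hw, rfl, hmax⟩ := exists_stdSimplex_weights_maximal
    (fun p : U => embedPt a b p) (fun p : U => (p.1.1 : ℝ) * p.1.2) hx
  have hcross : ∀ p q : U, w p ≠ 0 → w q ≠ 0 → Incompat U p q → p.1.1 < q.1.1 →
      q.1.2 < p.1.2 → False := by
    rintro ⟨⟨i, j⟩, hp⟩ ⟨⟨k, l⟩, hq⟩ hwp hwq hinc h1 h2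
    simp only at h1 h2
    have hr : (i, l) ∈ U := hinc.2 i l (by grind) (by grind) (by grind) (by grind)
    have hs : (k, j) ∈ U := hinc.2 k j (by grind) (by grind) (by grind) (by grind)
    have hle := add_le_add_of_stdSimplex_weights_maximal hw hmax (r := ⟨(i, l), hr⟩)
      (s := ⟨(k, j), hs⟩) (by grind) hwp hwq (embedPt_add_embedPt a b i j k l)
    have h1' : (i : ℝ) < k := by exact_mod_cast h1
    have h2' : (l : ℝ) < j := by exact_mod_cast h2
    simp only at hle
    nlinarith [mul_pos (sub_pos.2 h1') (sub_pos.2 h2')]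
  refine ⟨Subtype.val '' {p : U | w p ≠ 0}, by simp, ?_, ?_⟩
  · rintro _ ⟨p, hwp, rfl⟩ _ ⟨q, hwq, rfl⟩ - hinc
    rcases hinc.1 with ⟨h1, h2⟩ | ⟨h1, h2⟩
    · exact hcross p q hwp hwq hinc h1 h2
    · refine hcross q p hwq hwp ⟨.inl ⟨h1, h2⟩, fun k l => ?_⟩ h1 h2
      simpa only [min_comm, max_comm] using hinc.2 k l
  · rw [← Finset.sum_filter_of_ne (p := fun p => w p ≠ 0)
      fun p _ h h0 => h (by rw [h0, zero_smul])]
    refine (convex_convexHull ℝ _).sum_mem (fun p _ => hw.1 p) ?_ fun p hp => ?_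
    · rw [Finset.sum_filter_ne_zero, hw.2]
    · exact subset_convexHull ℝ _ ⟨p, ⟨p, (Finset.mem_filter.1 hp).2, rfl⟩, rfl⟩

/-- The polytope `𝒰_U = conv {(e_i, e_j) : (i,j) ∈ U}` is the union,
over all `U`-trees `T`, of the simplices `conv {(e_i, e_j) : (i,j) ∈ T}`. -/
theorem utree_triangulation_covers (a b : ℕ) (u : ℕ → ℕ) (hu : IsUnimodular a u)
    (hub : ∀ i, i ≤ a → u i ≤ b + 1) (hmax : ∃ i, i ≤ a ∧ u i = b + 1) :
    convexHull ℝ (embedPt a b '' stackSet a u) =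
      ⋃ T ∈ {T : Set (ℕ × ℕ) | IsUTree (stackSet a u) T},
        convexHull ℝ (embedPt a b '' T) := by
  refine Set.Subset.antisymm (fun x hx => ?_) (Set.iUnion₂_subset fun T hT =>
    convexHull_mono (Set.image_mono hT.1))
  obtain ⟨S, hSU, hS, hxS⟩ := exists_compat_subset_of_mem_convexHull (stackSet_finite a u) hx
  obtain ⟨T, hT, hST⟩ := exists_isUTree_superset (stackSet_finite a u) hSU hS
  exact Set.mem_biUnion hT (convexHull_mono (Set.image_mono hST) hxS)
end

section
/- For any two U-trees T and T', conv{(e_i, e_j) : (i,j) ∈ T} ∩ conv{(e_i, e_j) : (i,j) ∈ T'} = conv{(e_i, e_j) : (i,j) ∈ T ∩ T'}; that is, any two simplices of the U-Tamari triangulation of 𝒰_U intersect in a common face. -/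
/-- A stack set contains the rectangle spanned by a point `(i', j)` and a point `(i, j')` as soon
as it contains the corner `(i, j)`. -/
theorem stackSet_rectangle {a : ℕ} {u : ℕ → ℕ} (hu : IsUnimodular a u) {i i' j k l : ℕ}
    (h' : (i', j) ∈ stackSet a u) (h : (i, j) ∈ stackSet a u) (hk' : i' ≤ k) (hk : k ≤ i)
    (hl : l ≤ j) : (k, l) ∈ stackSet a u := by
  obtain ⟨-, m, hm, hinc, hdec⟩ := hu
  simp only [stackSet, Set.mem_ofPred_eq] at *
  refine ⟨by omega, ?_⟩
  rcases le_total k m with hkm | hkm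
  · have := hinc i' k hk' hkm
    omega
  · have := hdec k i hkm hk h.1
    omega

/-- Let `w` and `w'` be nonnegative weights on a stack set with the same sums over row `j` and
column `i`, agreeing below and to the right of `(i, j)`. If the support of `w'` is pairwise
compatible, then `w` does not exceed `w'` at `(i, j)`. -/
theorem le_of_eq_below_of_eq_right {a b : ℕ} {u : ℕ → ℕ} (hu : IsUnimodular a u)
    {w w' : ℕ × ℕ → ℝ} (hw : ∀ p, 0 ≤ w p) (hw' : ∀ p, 0 ≤ w' p)
    (hU : ∀ p, 0 < w p → p ∈ stackSet a u) (hU' : ∀ p, 0 < w' p → p ∈ stackSet a u)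
    (hC' : {p | 0 < w' p}.Pairwise (Compat (stackSet a u)))
    {i j : ℕ} (hi : i ∈ Finset.range (a + 1)) (hj : j ∈ Finset.range (b + 1))
    (hrow : ∑ k ∈ Finset.range (a + 1), w (k, j) = ∑ k ∈ Finset.range (a + 1), w' (k, j))
    (hcol : ∑ l ∈ Finset.range (b + 1), w (i, l) = ∑ l ∈ Finset.range (b + 1), w' (i, l))
    (hbelow : ∀ l, j < l → w (i, l) = w' (i, l)) (hright : ∀ k, i < k → w (k, j) = w' (k, j)) :
    w (i, j) ≤ w' (i, j) := by
  by_contra! hlt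
  obtain ⟨i', -, hi'⟩ : ∃ i' ∈ Finset.range (a + 1), w (i', j) < w' (i', j) := by
    by_contra! h
    exact (Finset.sum_lt_sum h ⟨i, hi, hlt⟩).ne' hrow
  obtain ⟨j', -, hj'⟩ : ∃ j' ∈ Finset.range (b + 1), w (i, j') < w' (i, j') := by
    by_contra! h
    exact (Finset.sum_lt_sum h ⟨j, hj, hlt⟩).ne' hcol
  have hii : i' < i := by
    by_contra! h
    rcases h.eq_or_lt with rfl | h
    · exact lt_asymm hlt hi'
    · exact hi'.ne (hright i' h)
  have hjj : j' < j := by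
    by_contra! h
    rcases h.eq_or_lt with rfl | h
    · exact lt_asymm hlt hj'
    · exact hj'.ne (hbelow j' h)
  have hij : (i, j) ∈ stackSet a u := hU _ ((hw' _).trans_lt hlt)
  have hpos' : 0 < w' (i', j) := (hw _).trans_lt hi'
  refine hC' hpos' ((hw _).trans_lt hj' : 0 < w' (i, j')) (by simp [hii.ne])
    ⟨Or.inl ⟨hii, hjj⟩, fun k l hk hk' _ hl => ?_⟩
  simp only [min_eq_left hii.le, max_eq_right hii.le, max_eq_left hjj.le] at hk hk' hl
  exact stackSet_rectangle hu (hU' _ hpos') hij hk hk' hl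

/-- Nonnegative weights on a stack set with pairwise compatible support are determined by their
row and column sums. -/
theorem eq_of_marginals_eq {a b : ℕ} {u : ℕ → ℕ} (hu : IsUnimodular a u)
    (hub : ∀ i, i ≤ a → u i ≤ b + 1) {w w' : ℕ × ℕ → ℝ}
    (hw : ∀ p, 0 ≤ w p) (hw' : ∀ p, 0 ≤ w' p)
    (hU : ∀ p, 0 < w p → p ∈ stackSet a u) (hU' : ∀ p, 0 < w' p → p ∈ stackSet a u)
    (hC : {p | 0 < w p}.Pairwise (Compat (stackSet a u)))
    (hC' : {p | 0 < w' p}.Pairwise (Compat (stackSet a u)))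
    (hrow : ∀ j ∈ Finset.range (b + 1),
      ∑ k ∈ Finset.range (a + 1), w (k, j) = ∑ k ∈ Finset.range (a + 1), w' (k, j))
    (hcol : ∀ i ∈ Finset.range (a + 1),
      ∑ l ∈ Finset.range (b + 1), w (i, l) = ∑ l ∈ Finset.range (b + 1), w' (i, l)) :
    w = w' := by
  have houter (i j : ℕ) (h : ¬ (i ≤ a ∧ j ≤ b)) : w (i, j) = w' (i, j) := by
    have hnot : (i, j) ∉ stackSet a u := fun hm => h ⟨hm.1, by
      have := hub i hm.1
      have : j < u i := hm.2
      omega⟩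
    rw [le_antisymm (not_lt.1 fun h => hnot (hU _ h)) (hw _),
      le_antisymm (not_lt.1 fun h => hnot (hU' _ h)) (hw' _)]
  have key (m : ℕ) : ∀ j, b < j + m → ∀ i, w (i, j) = w' (i, j) := by
    induction m with
    | zero => exact fun j hj i => houter i j (by omega)
    | succ m ihm =>
      intro j hj
      have hright (n : ℕ) : ∀ i, a < i + n → w (i, j) = w' (i, j) := by
        induction n with
        | zero => exact fun i hi => houter i j (by omega)
        | succ n ihn =>
          intro i hi
          by_cases hin : i ≤ a ∧ j ≤ b
          · have hi' : i ∈ Finset.range (a + 1) := Finset.mem_range.2 (by omega)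
            have hj' : j ∈ Finset.range (b + 1) := Finset.mem_range.2 (by omega)
            have hbelow (l : ℕ) (hl : j < l) : w (i, l) = w' (i, l) := ihm l (by omega) i
            have hr (k : ℕ) (hk : i < k) : w (k, j) = w' (k, j) := ihn k (by omega)
            exact le_antisymm
              (le_of_eq_below_of_eq_right hu hw hw' hU hU' hC' hi' hj' (hrow j hj') (hcol i hi')
                hbelow hr)
              (le_of_eq_below_of_eq_right hu hw' hw hU' hU hC hi' hj' (hrow j hj').symm
                (hcol i hi').symm (fun l hl => (hbelow l hl).symm) fun k hk => (hr k hk).symm)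
          · exact houter i j hin
      exact fun i => hright (a + 1) i (by omega)
  funext ⟨i, j⟩
  exact key (b + 1) j (by omega) i

/-- Points of `conv {(e_i, e_j) : (i, j) ∈ T}` are given by weights supported on `T`. -/
theorem exists_weights_of_mem_convexHull {a b : ℕ} {T : Set (ℕ × ℕ)} {s : Finset (ℕ × ℕ)}
    (hTs : T ⊆ s) {x : (Fin (a + 1) → ℝ) × (Fin (b + 1) → ℝ)}
    (hx : x ∈ convexHull ℝ (embedPt a b '' T)) :
    ∃ w : ℕ × ℕ → ℝ, (∀ p, 0 ≤ w p) ∧ (∀ p, 0 < w p → p ∈ T) ∧ ∑ p ∈ s, w p = 1 ∧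
      ∑ p ∈ s, w p • embedPt a b p = x := by
  classical
  refine convexHull_min (t := {x | ∃ w : ℕ × ℕ → ℝ, (∀ p, 0 ≤ w p) ∧ (∀ p, 0 < w p → p ∈ T) ∧
    ∑ p ∈ s, w p = 1 ∧ ∑ p ∈ s, w p • embedPt a b p = x}) ?_ ?_ hx
  · rintro _ ⟨q, hq, rfl⟩
    refine ⟨Pi.single q 1, fun p => ?_, fun p hp => ?_, ?_, ?_⟩
    · by_cases h : p = q <;> simp [h]
    · by_contra hpT
      have : p ≠ q := fun h => hpT (h ▸ hq)
      simp [this] at hp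
    · simpa [Pi.single_apply] using hTs hq
    · simpa [Pi.single_apply, ite_smul] using fun h => absurd (Finset.mem_coe.1 (hTs hq)) h
  · rintro x ⟨w, hw0, hwT, hw1, rfl⟩ y ⟨v, hv0, hvT, hv1, rfl⟩ c d hc hd hcd
    refine ⟨c • w + d • v, fun p => ?_, fun p hp => ?_, ?_, ?_⟩
    · exact add_nonneg (mul_nonneg hc (hw0 p)) (mul_nonneg hd (hv0 p))
    · by_contra hpT
      have h1 : w p = 0 := le_antisymm (not_lt.1 fun h => hpT (hwT p h)) (hw0 p)
      have h2 : v p = 0 := le_antisymm (not_lt.1 fun h => hpT (hvT p h)) (hv0 p)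
      simp [h1, h2] at hp
    · simp [Finset.sum_add_distrib, ← Finset.mul_sum, hw1, hv1, hcd]
    · simp [add_smul, Finset.sum_add_distrib, Finset.smul_sum, mul_smul]

/-- The coordinates of a combination of the points `(e_i, e_j)` are the column and row sums of
its weights. -/
theorem sum_smul_embedPt (a b : ℕ) (w : ℕ × ℕ → ℝ) :
    ∑ p ∈ Finset.range (a + 1) ×ˢ Finset.range (b + 1), w p • embedPt a b p =
      (fun i : Fin (a + 1) => ∑ l ∈ Finset.range (b + 1), w (i, l),
        fun j : Fin (b + 1) => ∑ k ∈ Finset.range (a + 1), w (k, j)) := by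
  refine Prod.ext (funext fun i => ?_) (funext fun j => ?_)
  · rw [Prod.fst_sum, Finset.sum_apply, Finset.sum_product_right]
    refine Finset.sum_congr rfl fun l _ => ?_
    simp [embedPt, i.is_le]
  · rw [Prod.snd_sum, Finset.sum_apply, Finset.sum_product]
    refine Finset.sum_congr rfl fun k _ => ?_
    simp [embedPt, j.is_le]

/-- Any two simplices of the `U`-Tamari triangulation of `𝒰_U` intersect
in a common face: for `U`-trees `T`, `T'`,
`conv {(e_i,e_j) : (i,j) ∈ T} ∩ conv {(e_i,e_j) : (i,j) ∈ T'} =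
conv {(e_i,e_j) : (i,j) ∈ T ∩ T'}`. -/
theorem utree_simplices_intersect_in_face (a b : ℕ) (u : ℕ → ℕ) (hu : IsUnimodular a u)
    (hub : ∀ i, i ≤ a → u i ≤ b + 1) (hmax : ∃ i, i ≤ a ∧ u i = b + 1)
    (T T' : Set (ℕ × ℕ)) (hT : IsUTree (stackSet a u) T) (hT' : IsUTree (stackSet a u) T') :
    convexHull ℝ (embedPt a b '' T) ∩ convexHull ℝ (embedPt a b '' T') =
      convexHull ℝ (embedPt a b '' (T ∩ T')) := by
  classical
  refine Set.Subset.antisymm ?_ (Set.subset_inter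
    (convexHull_mono (Set.image_mono Set.inter_subset_left))
    (convexHull_mono (Set.image_mono Set.inter_subset_right)))
  rintro x ⟨hx, hx'⟩
  have hbox : stackSet a u ⊆ ↑(Finset.range (a + 1) ×ˢ Finset.range (b + 1)) := by
    rintro ⟨i, j⟩ ⟨hi, hj⟩
    have := hub i hi
    simp only [Finset.coe_product, Set.mem_prod, Finset.mem_coe, Finset.mem_range] at *
    omega
  obtain ⟨w, hw, hwT, hw1, hwx⟩ := exists_weights_of_mem_convexHull (hT.1.trans hbox) hx
  obtain ⟨w', hw', hwT', -, hwx'⟩ := exists_weights_of_mem_convexHull (hT'.1.trans hbox) hx'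
  have heq := hwx.trans hwx'.symm
  rw [sum_smul_embedPt, sum_smul_embedPt, Prod.mk.injEq] at heq
  obtain rfl : w = w' := eq_of_marginals_eq hu hub hw hw' (fun p h => hT.1 (hwT p h))
    (fun p h => hT'.1 (hwT' p h)) (hT.2.1.mono hwT) (hT'.2.1.mono hwT')
    (fun j hj => congrFun heq.2 ⟨j, Finset.mem_range.1 hj⟩)
    fun i hi => congrFun heq.1 ⟨i, Finset.mem_range.1 hi⟩
  have hzero (p : ℕ × ℕ) (hp : p ∉ T ∩ T') : w p = 0 :=
    le_antisymm (not_lt.1 fun h => hp ⟨hwT p h, hwT' p h⟩) (hw p)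
  rw [← hwx, ← Finset.sum_filter_of_ne (p := (· ∈ T ∩ T')) fun p _ h => by
    by_contra hp
    exact h (by rw [hzero p hp, zero_smul])]
  refine (convex_convexHull ℝ _).sum_mem (fun p _ => hw p) ?_ fun p hp =>
    subset_convexHull ℝ _ (Set.mem_image_of_mem _ (Finset.mem_filter.1 hp).2)
  rw [Finset.sum_filter_of_ne fun p _ h => ?_, hw1]
  by_contra hp
  exact h (hzero p hp)
end

section
/- Let h : U → ℝ be a non-crossing height function and A ⊆ U. Then there exist x ∈ ℝ^{a+1} and y ∈ ℝ^{b+1} with x_i + y_j = h(i,j) for all (i,j) ∈ A and x_i + y_j ≥ h(i,j) for all (i,j) ∈ U, if and only if the elements of A are pairwise U-compatible. (Equivalently: the polyhedron g̃(A) is non-empty if and only if A is a face of the U-Tamari complex.) -/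
/-- A height function `h` on `U` is non-crossing if for every rectangle with its four
corners in `U`, the sum of the heights of the upper-left and lower-right corners is
strictly bigger than the sum of the heights of the lower-left and upper-right corners. -/
def NonCrossing (U : Set (ℕ × ℕ)) (h : ℕ × ℕ → ℝ) : Prop :=
  ∀ i i' j j' : ℕ, i < i' → j < j' → (i, j) ∈ U → (i, j') ∈ U → (i', j) ∈ U →
    (i', j') ∈ U → h (i, j') + h (i', j) < h (i, j) + h (i', j')

/-- The potentials `x` on columns and `y` on rows dominate `h` on the top-aligned columns
`i ∈ S` of heights `u i`, with equality on the points of `A` in these columns. -/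
def IsTightPotential (u : ℕ → ℕ) (h : ℕ → ℕ → ℝ) (S : Set ℕ) (A : ℕ → ℕ → Prop)
    (x y : ℕ → ℝ) : Prop :=
  ∀ i ∈ S, (∀ j, A i j → x i + y j = h i j) ∧ ∀ j, j < u i → h i j ≤ x i + y j

/-- Potentials extend to a new column `c` with value `κ`, by raising `y` on rows that carry
no point of `A` outside column `c`. -/
theorem IsTightPotential.insert {u : ℕ → ℕ} {h : ℕ → ℕ → ℝ} {S : Set ℕ} {A : ℕ → ℕ → Prop}
    {x y : ℕ → ℝ} (hxy : IsTightPotential u h S A x y) {c : ℕ} (hc : c ∉ S) (κ : ℝ)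
    (hfree : ∀ j, j < u c → h c j - y j ≤ κ ∨ ∀ i ∈ S, ¬ A i j)
    (hA : ∀ j, A c j → j < u c ∧ κ ≤ h c j - y j) :
    ∃ x' y', IsTightPotential u h (insert c S) A x' y' := by
  refine ⟨Function.update x c κ, fun j => if j < u c then max (y j) (h c j - κ) else y j, ?_⟩
  have hy : ∀ j, y j ≤ if j < u c then max (y j) (h c j - κ) else y j := by
    intro j
    split_ifs
    · exact le_max_left _ _
    · exact le_rfl
  rintro i (rfl | hi)
  · simp only [Function.update_self]
    refine ⟨fun j hj => ?_, fun j hj => ?_⟩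
    · obtain ⟨h1, h2⟩ := hA j hj
      rw [if_pos h1, max_eq_right (by linarith)]
      ring
    · rw [if_pos hj]
      linarith [le_max_right (y j) (h i j - κ)]
  · have hne : i ≠ c := fun e => hc (e ▸ hi)
    simp only [Function.update_of_ne hne]
    refine ⟨fun j hj => ?_, fun j hj => ?_⟩
    · rw [← (hxy i hi).1 j hj]
      split_ifs with hju
      · rcases hfree j hju with h1 | h1
        · rw [max_eq_left (by linarith)]
        · exact absurd hj (h1 i hi)
      · rfl
    · linarith [(hxy i hi).2 j hj, hy j]

/-- On an interval of columns whose heights have no interior strict dip, a set of points without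
incompatible pairs admits tight potentials. -/
theorem exists_isTightPotential_Icc (a : ℕ) (u : ℕ → ℕ) (hpos : ∀ i, i ≤ a → 0 < u i)
    (hu : ∀ i k j, i ≤ k → k ≤ j → j ≤ a → min (u i) (u j) ≤ u k)
    (h : ℕ → ℕ → ℝ)
    (hnc : ∀ i i' j j', i < i' → i' ≤ a → j < j' → j' < u i → j' < u i' →
      h i j' + h i' j < h i j + h i' j')
    (n p : ℕ) (hpn : p + n ≤ a) (A : ℕ → ℕ → Prop)
    (hA : ∀ i j, A i j → j < u i)
    (hAnc : ∀ i i' j j', p ≤ i → i < i' → i' ≤ p + n → j < j' → A i j' → A i' j → u i' ≤ j') :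
    ∃ x y, IsTightPotential u h (Set.Icc p (p + n)) A x y := by
  induction n generalizing p A with
  | zero =>
    refine ⟨fun _ => 0, h p, fun i hi => ?_⟩
    obtain rfl : i = p := by simpa using hi
    simp
  | succ n ih =>
    have hends : (∀ k, p ≤ k → k ≤ p + (n + 1) → u p ≤ u k) ∨
        (∀ k, p ≤ k → k ≤ p + (n + 1) → u (p + (n + 1)) ≤ u k) := by
      rcases le_total (u p) (u (p + (n + 1))) with hle | hle
      · exact Or.inl fun k hk hk' => by simpa [hle] using hu p k _ hk hk' hpn
      · exact Or.inr fun k hk hk' => by simpa [hle] using hu p k _ hk hk' hpn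
    rcases hends with hmin | hmin
    · obtain ⟨t, ht, htmax⟩ : ∃ t, (A p t ∨ t = 0) ∧ ∀ j, A p j → j ≤ t := by
        classical
        have hne : A p (Nat.findGreatest (fun t => A p t ∨ t = 0) (u p)) ∨ _ :=
          Nat.findGreatest_spec (P := fun t => A p t ∨ t = 0) (Nat.zero_le (u p)) (Or.inr rfl)
        exact ⟨_, hne, fun j hj => Nat.le_findGreatest (hA p j hj).le (Or.inl hj)⟩
      have htu : t < u p := by
        rcases ht with ht | rfl
        · exact hA p t ht
        · exact hpos p (by omega)
      have hlow : ∀ i j, p < i → i ≤ p + (n + 1) → A i j → t ≤ j := by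
        intro i j hi hi' hij
        by_contra! hlt
        rcases ht with ht | rfl
        · have := hAnc p i j t le_rfl hi hi' hlt ht hij
          have := hmin i hi.le hi'
          omega
        · omega
      obtain ⟨x, y, hxy⟩ := ih (p + 1) (by omega)
        (fun i j => A i j ∨ i = p + 1 ∧ (A p j ∨ j = t))
        (by
          rintro i j (hij | ⟨rfl, hj⟩)
          · exact hA i j hij
          · have := hmin (p + 1) (by omega) (by omega)
            rcases hj with hj | rfl
            · have := hA p j hj
              omega
            · omega)
        (by
          rintro i i' j j' hi hii hi' hjj (h1 | ⟨rfl, h1⟩) (h2 | ⟨rfl, h2⟩)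
          · exact hAnc i i' j j' (by omega) hii (by omega) hjj h1 h2
          · omega
          · have := hlow i' j (by omega) (by omega) h2
            have : j' ≤ t := by
              rcases h1 with h1 | rfl
              · exact htmax j' h1
              · exact le_rfl
            omega
          · omega)
      have htight := hxy (p + 1) ⟨by omega, by omega⟩
      have hteq := htight.1 t (by simp)
      have hS : Set.Icc p (p + (n + 1)) = insert p (Set.Icc (p + 1) (p + 1 + n)) := by
        ext i
        simp only [Set.mem_Icc, Set.mem_insert_iff]
        omega
      rw [hS]
      refine IsTightPotential.insert
        (fun i hi => ⟨fun j hj => (hxy i hi).1 j (Or.inl hj), (hxy i hi).2⟩)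
        (by simp) (h p t - y t) (fun j hj => ?_) (fun j hj => ⟨hA p j hj, ?_⟩)
      · have hj' : j < u (p + 1) := hj.trans_le (hmin (p + 1) (by omega) (by omega))
        rcases lt_trichotomy j t with hjt | rfl | hjt
        · refine Or.inr fun i hi hij => ?_
          have := hlow i j hi.1 (by have := hi.2; omega) hij
          omega
        · exact Or.inl le_rfl
        · left
          have := hnc p (p + 1) t j (by omega) (by omega) hjt hj hj'
          have := htight.2 j hj'
          linarith
      · rcases (htmax j hj).lt_or_eq with hjt | rfl
        · have := hnc p (p + 1) j t (by omega) (by omega) hjt htu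
            (htu.trans_le (hmin (p + 1) (by omega) (by omega)))
          have := htight.1 j (Or.inr ⟨rfl, Or.inl hj⟩)
          linarith
        · exact le_rfl
    · set q := p + (n + 1) with hq
      classical
      obtain ⟨t, ht, htmin⟩ : ∃ t, (A q t ∨ t = u q - 1) ∧ ∀ j, A q j → t ≤ j := by
        have hex : ∃ t, A q t ∨ t = u q - 1 := ⟨_, Or.inr rfl⟩
        exact ⟨Nat.find hex, Nat.find_spec hex, fun j hj => Nat.find_min' hex (Or.inl hj)⟩
      have hqpos := hpos q hpn
      have htu : t < u q := by
        rcases ht with ht | rfl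
        · exact hA q t ht
        · omega
      have hgap : ∀ i j, p ≤ i → i < q → A i j → t < j → u q ≤ j := by
        intro i j hi hi' hij hlt
        rcases ht with ht | rfl
        · exact hAnc i q t j hi hi' le_rfl hlt hij ht
        · omega
      obtain ⟨r, hpr, hrq, hr, hrmax⟩ : ∃ r, p ≤ r ∧ r < q ∧ (r = p ∨ ∃ l, l ≤ t ∧ A r l) ∧
          ∀ i l, p ≤ i → i < q → l ≤ t → A i l → i ≤ r := by
        let P : ℕ → Prop := fun r => p ≤ r ∧ (r = p ∨ ∃ l, l ≤ t ∧ A r l)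
        have hspec : P (Nat.findGreatest P (p + n)) :=
          Nat.findGreatest_spec (m := p) (by omega) ⟨le_rfl, Or.inl rfl⟩
        have hbound := Nat.findGreatest_le (P := P) (p + n)
        exact ⟨_, hspec.1, by omega, hspec.2, fun i l hi hi' hl hil =>
          Nat.le_findGreatest (by omega) ⟨hi, Or.inr ⟨l, hl, hil⟩⟩⟩
      have hqr : u q ≤ u r := hmin r hpr hrq.le
      obtain ⟨x, y, hxy⟩ := ih p (by omega)
        (fun i j => A i j ∨ i = r ∧ (A q j ∨ j = t))
        (by
          rintro i j (hij | ⟨rfl, hj⟩)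
          · exact hA i j hij
          · rcases hj with hj | rfl
            · exact (hA q j hj).trans_le hqr
            · omega)
        (by
          have hJ : ∀ j, A q j ∨ j = t → t ≤ j ∧ j < u q := by
            rintro j (hj | rfl)
            · exact ⟨htmin j hj, hA q j hj⟩
            · exact ⟨le_rfl, htu⟩
          rintro i i' j j' hi hii hi' hjj (h1 | ⟨rfl, h1⟩) (h2 | ⟨rfl, h2⟩)
          · exact hAnc i i' j j' hi hii (by omega) hjj h1 h2
          · obtain ⟨hj1, hj2⟩ := hJ j h2
            rcases hr with rfl | ⟨l, hl, hrl⟩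
            · omega
            · exact hAnc i i' l j' hi hii hrq.le (by omega) h1 hrl
          · obtain ⟨hj1, hj2⟩ := hJ j' h1
            rcases le_or_gt j t with hjt | hjt
            · have := hrmax i' j (by omega) (by omega) hjt h2
              omega
            · have := hgap i' j (by omega) (by omega) h2 hjt
              omega
          · omega)
      have htight := hxy r ⟨hpr, by omega⟩
      have hteq := htight.1 t (by simp)
      have hS : Set.Icc p q = insert q (Set.Icc p (p + n)) := by
        ext i
        simp only [Set.mem_Icc, Set.mem_insert_iff]
        omega
      rw [hS]
      refine IsTightPotential.insert
        (fun i hi => ⟨fun j hj => (hxy i hi).1 j (Or.inl hj), (hxy i hi).2⟩)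
        (by simp [hq]) (h q t - y t) (fun j hj => ?_) (fun j hj => ⟨hA q j hj, ?_⟩)
      · rcases lt_trichotomy j t with hjt | rfl | hjt
        · left
          have := hnc r q j t hrq hpn hjt (htu.trans_le hqr) htu
          have := htight.2 j (by omega)
          linarith
        · exact Or.inl le_rfl
        · refine Or.inr fun i hi hij => ?_
          have := hgap i j hi.1 (by have := hi.2; omega) hij hjt
          omega
      · rcases (htmin j hj).lt_or_eq with hjt | rfl
        · have hju := hA q j hj
          have := hnc r q t j hrq hpn hjt (hju.trans_le hqr) hju
          have := htight.1 j (Or.inr ⟨rfl, Or.inl hj⟩)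
          linarith
        · exact le_rfl

/-- Unimodular sequences are quasi-concave. -/
theorem IsUnimodular.min_le {a : ℕ} {u : ℕ → ℕ} (hu : IsUnimodular a u) {i k j : ℕ}
    (hik : i ≤ k) (hkj : k ≤ j) (hja : j ≤ a) : min (u i) (u j) ≤ u k := by
  obtain ⟨-, m, -, hinc, hdec⟩ := hu
  rcases le_total k m with hkm | hmk
  · exact (min_le_left _ _).trans (hinc i k hik hkm)
  · exact (min_le_right _ _).trans (hdec k j hmk hkj hja)

/-- In a stack set, a point strictly southwest of another one is incompatible with it as soon as
the lower-right corner of the rectangle they span lies in the stack set. -/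
theorem IsUnimodular.incompat {a : ℕ} {u : ℕ → ℕ} (hu : IsUnimodular a u) {i i' j j' : ℕ}
    (hi : i < i') (hj : j < j') (hij : (i, j') ∈ stackSet a u) (hij' : (i', j') ∈ stackSet a u) :
    Incompat (stackSet a u) (i, j') (i', j) := by
  refine ⟨Or.inl ⟨hi, hj⟩, fun k l hk hk' _ hl' => ?_⟩
  simp only [stackSet, Set.mem_ofPred_eq] at *
  have := hu.min_le (i := i) (k := k) (j := i') (by omega) (by omega) hij'.1
  omega

/-- Let `h` be a non-crossing height function on `U` and `A ⊆ U`.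
There exist `x ∈ ℝ^{a+1}` and `y ∈ ℝ^{b+1}` with `x_i + y_j = h(i,j)` for all
`(i,j) ∈ A` and `x_i + y_j ≥ h(i,j)` for all `(i,j) ∈ U` if and only if the elements of
`A` are pairwise `U`-compatible (the polyhedron `g̃(A)` is non-empty iff `A` is a face of
the `U`-Tamari complex). -/
theorem gtilde_nonempty_iff_face (a b : ℕ) (u : ℕ → ℕ) (hu : IsUnimodular a u)
    (hub : ∀ i, i ≤ a → u i ≤ b + 1) (hmax : ∃ i, i ≤ a ∧ u i = b + 1)
    (h : ℕ × ℕ → ℝ) (hnc : NonCrossing (stackSet a u) h)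
    (A : Set (ℕ × ℕ)) (hA : A ⊆ stackSet a u) :
    (∃ (x : Fin (a + 1) → ℝ) (y : Fin (b + 1) → ℝ),
        (∀ (i : Fin (a + 1)) (j : Fin (b + 1)),
          ((i : ℕ), (j : ℕ)) ∈ A → x i + y j = h ((i : ℕ), (j : ℕ))) ∧
        (∀ (i : Fin (a + 1)) (j : Fin (b + 1)),
          ((i : ℕ), (j : ℕ)) ∈ stackSet a u → h ((i : ℕ), (j : ℕ)) ≤ x i + y j)) ↔
      A.Pairwise (Compat (stackSet a u)) := by
  have hnot : ∀ {x : Fin (a + 1) → ℝ} {y : Fin (b + 1) → ℝ},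
      (∀ (i : Fin (a + 1)) (j : Fin (b + 1)),
        ((i : ℕ), (j : ℕ)) ∈ A → x i + y j = h ((i : ℕ), (j : ℕ))) →
      (∀ (i : Fin (a + 1)) (j : Fin (b + 1)),
        ((i : ℕ), (j : ℕ)) ∈ stackSet a u → h ((i : ℕ), (j : ℕ)) ≤ x i + y j) →
      ∀ i i' j j' : ℕ, i < i' → j < j' → (i, j') ∈ A → (i', j) ∈ A →
        (i, j) ∈ stackSet a u → (i', j') ∈ stackSet a u → False := by
    intro x y heq hle i i' j j' hi hj h1 h2 h3 h4
    have hlt := hnc i i' j j' hi hj h3 (hA h1) (hA h2) h4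
    have hi' : i' < a + 1 := Nat.lt_succ_of_le h4.1
    have hj' : j' < b + 1 := h4.2.trans_le (hub i' h4.1)
    have e1 := heq ⟨i, hi.trans hi'⟩ ⟨j', hj'⟩ h1
    have e2 := heq ⟨i', hi'⟩ ⟨j, hj.trans hj'⟩ h2
    have e3 := hle ⟨i, hi.trans hi'⟩ ⟨j, hj.trans hj'⟩ h3
    have e4 := hle ⟨i', hi'⟩ ⟨j', hj'⟩ h4
    simp only at e1 e2 e3 e4
    linarith
  constructor
  · rintro ⟨x, y, heq, hle⟩ ⟨i, j⟩ hp ⟨i', j'⟩ hq _ ⟨hor, hrect⟩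
    simp only at hor hrect
    rcases hor with ⟨hi, hj⟩ | ⟨hi, hj⟩
    · exact hnot heq hle i i' j' j hi hj hp hq
        (hrect _ _ (by omega) (by omega) (by omega) (by omega))
        (hrect _ _ (by omega) (by omega) (by omega) (by omega))
    · exact hnot heq hle i' i j j' hi hj hq hp
        (hrect _ _ (by omega) (by omega) (by omega) (by omega))
        (hrect _ _ (by omega) (by omega) (by omega) (by omega))
  · intro hcompat
    obtain ⟨x, y, hxy⟩ := exists_isTightPotential_Icc a u hu.1
      (fun i k j hik hkj hja => hu.min_le hik hkj hja) (fun i j => h (i, j))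
      (fun i i' j j' hi hi' hj hj1 hj2 => hnc i i' j j' hi hj ⟨by omega, hj.trans hj1⟩
        ⟨by omega, hj1⟩ ⟨hi', hj.trans hj2⟩ ⟨hi', hj2⟩)
      a 0 (by omega) (fun i j => (i, j) ∈ A) (fun i j hij => (hA hij).2)
      (by
        intro i i' j j' _ hi hi' hj h1 h2
        by_contra! hlt
        exact hcompat h1 h2 (by simp [hi.ne])
          (hu.incompat hi hj (hA h1) ⟨by omega, hlt⟩))
    have hmem : ∀ i : Fin (a + 1), (i : ℕ) ∈ Set.Icc 0 (0 + a) :=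
      fun i => ⟨Nat.zero_le _, by omega⟩
    exact ⟨fun i => x i, fun j => y j, fun i j hij => (hxy i (hmem i)).1 j hij,
      fun i j hij => (hxy i (hmem i)).2 j hij.2⟩
end
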